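/- Let n ≥ 3 and p > n − 1. There is no homeomorphism h : 𝔹 → 𝔹 ∖ I from the unit ball onto the slit ball with h ∈ W^{1,n}(𝔹, ℝⁿ) (finite conformal energy) whose inverse f = h⁻¹ belongs to W^{1,p}(𝔹 ∖ I, ℝⁿ). -/

import Mathlib

open MeasureTheory Metric Set
open scoped ENNReal NNReal

noncomputable section

abbrev Euc (n : ℕ) : Type := EuclideanSpace ℝ (Fin n)

/-- Operator norm of an `n × n` real matrix, viewed as a linear operator on Euclidean space. -/
noncomputable def opNorm {n : ℕ} (M : Matrix (Fin n) (Fin n) ℝ) : ℝ :=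
  ‖LinearMap.toContinuousLinearMap (Matrix.toEuclideanLin M)‖

/-- `g` belongs to the Sobolev class `W^{1,p}(Ω, ℝⁿ)` with weak differential `Dg`:
`g` and `Dg` are locally integrable on `Ω`, the integration-by-parts identity holds against
every smooth compactly supported test function supported in `Ω`, and `|Dg| ∈ L^p(Ω)`. -/
structure MemSobolev {n : ℕ} (p : ℝ) (Ω : Set (Euc n))
    (g : Euc n → Euc n) (Dg : Euc n → Matrix (Fin n) (Fin n) ℝ) : Prop where
  locInt : ∀ i : Fin n, LocallyIntegrableOn (fun x => g x i) Ω volume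
  locIntD : ∀ i j : Fin n, LocallyIntegrableOn (fun x => Dg x i j) Ω volume
  parts : ∀ φ : Euc n → ℝ, ContDiff ℝ ((⊤ : ℕ∞) : WithTop ℕ∞) φ → HasCompactSupport φ →
    tsupport φ ⊆ Ω → ∀ i j : Fin n,
      ∫ x in Ω, g x i * fderiv ℝ φ x (EuclideanSpace.single j 1) =
        - ∫ x in Ω, Dg x i j * φ x
  lp : IntegrableOn (fun x => opNorm (Dg x) ^ p) Ω volume

/-- `g` belongs to the local Sobolev class `W^{1,1}_loc(Ω, ℝⁿ)` with weak differential `Dg`. -/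
structure MemSobolevLoc {n : ℕ} (Ω : Set (Euc n))
    (g : Euc n → Euc n) (Dg : Euc n → Matrix (Fin n) (Fin n) ℝ) : Prop where
  locInt : ∀ i : Fin n, LocallyIntegrableOn (fun x => g x i) Ω volume
  locIntD : ∀ i j : Fin n, LocallyIntegrableOn (fun x => Dg x i j) Ω volume
  parts : ∀ φ : Euc n → ℝ, ContDiff ℝ ((⊤ : ℕ∞) : WithTop ℕ∞) φ → HasCompactSupport φ →
    tsupport φ ⊆ Ω → ∀ i j : Fin n,
      ∫ x in Ω, g x i * fderiv ℝ φ x (EuclideanSpace.single j 1) =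
        - ∫ x in Ω, Dg x i j * φ x

/-- `h : 𝕏 → 𝕐` is a homeomorphism of `𝕏` onto `𝕐` with inverse `f`. -/
structure IsHomeoOn {n : ℕ} (h f : Euc n → Euc n) (𝕏 𝕐 : Set (Euc n)) : Prop where
  mapsTo : Set.MapsTo h 𝕏 𝕐
  mapsTo_inv : Set.MapsTo f 𝕐 𝕏
  left_inv : ∀ x ∈ 𝕏, f (h x) = x
  right_inv : ∀ y ∈ 𝕐, h (f y) = y
  continuousOn : ContinuousOn h 𝕏
  continuousOn_inv : ContinuousOn f 𝕐

/-- The inner distortion function `K_I(·, h)` of a Sobolev map with weak differential `Dh`;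
`D♯h` is the cofactor (adjugate) matrix, given by Cramer's rule `(D♯h)(Dh) = (det Dh)·Id`. -/
noncomputable def innerDistortion {n : ℕ} (Dh : Euc n → Matrix (Fin n) (Fin n) ℝ)
    (x : Euc n) : ℝ≥0∞ :=
  if 0 < (Dh x).det then
    ENNReal.ofReal (opNorm ((Dh x).adjugate) ^ n / (Dh x).det ^ (n - 1))
  else if (Dh x).adjugate = 0 then 1 else ⊤

/-- The open unit ball `𝔹 ⊂ ℝⁿ`. -/
def unitBall (n : ℕ) : Set (Euc n) := Metric.ball 0 1

/-- The slit `I = {(t,0) : 0 ≤ t < 1}`, the first coordinate playing the role of `t`. -/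
def slit (n : ℕ) [NeZero n] : Set (Euc n) :=
  {p | 0 ≤ p 0 ∧ p 0 < 1 ∧ ∀ i : Fin n, i ≠ 0 → p i = 0}

/-- The model inward-cusp ball `𝔹_u = 𝔹 \ {(t,x) : t ≥ 0, |x| ≤ u(t)}`. -/
noncomputable def cuspBall (n : ℕ) [NeZero n] (u : ℝ → ℝ) : Set (Euc n) :=
  Metric.ball 0 1 \
    {p | 0 ≤ p 0 ∧ Real.sqrt (∑ i ∈ Finset.univ.erase (0 : Fin n), p i ^ 2) ≤ u (p 0)}

/-- `u` is a model cusp profile: a strictly increasing continuous surjection of `[0,∞)` onto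
itself, `C¹` on `(0,∞)`, with `u′` increasing on `(0,∞)`, `u′(s) → 0` as `s → 0⁺`, `u(1) = 1`. -/
structure IsModelCusp (u : ℝ → ℝ) : Prop where
  continuousOn : ContinuousOn u (Set.Ici 0)
  contDiffOn : ContDiffOn ℝ 1 u (Set.Ioi 0)
  strictMonoOn : StrictMonoOn u (Set.Ici 0)
  mapsTo : Set.MapsTo u (Set.Ici 0) (Set.Ici 0)
  surjOn : Set.SurjOn u (Set.Ici 0) (Set.Ici 0)
  deriv_mono : MonotoneOn (deriv u) (Set.Ioi 0)
  deriv_tendsto : Filter.Tendsto (deriv u) (nhdsWithin 0 (Set.Ioi 0)) (nhds 0)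
  one : u 1 = 1

/-- The cusp profile `u(t) = e / exp(t^{-α})` for `t > 0`, and `u(0) = 0`. -/
noncomputable def cuspFun (α : ℝ) (t : ℝ) : ℝ :=
  if 0 < t then Real.exp 1 / Real.exp (t ^ (-α)) else 0

/-- The sphere `S_t = {y ∈ 𝔹_u : |y| = t}` inside the cusp ball. -/
def cuspS (n : ℕ) [NeZero n] (u : ℝ → ℝ) (t : ℝ) : Set (Euc n) :=
  {y ∈ cuspBall n u | ‖y‖ = t}

/-- The boundary circle `C_t = {y ∈ ∂𝔹_u : |y| = t}`. -/
def cuspC (n : ℕ) [NeZero n] (u : ℝ → ℝ) (t : ℝ) : Set (Euc n) :=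
  {y ∈ frontier (cuspBall n u) | ‖y‖ = t}

/-- `S′_t = h⁻¹(S_t) ⊆ 𝔹`. -/
def cuspS' (n : ℕ) [NeZero n] (u : ℝ → ℝ) (h : Euc n → Euc n) (t : ℝ) : Set (Euc n) :=
  {x ∈ unitBall n | h x ∈ cuspS n u t}

/-- `C′_t = cl(S′_t) ∩ ∂𝔹`. -/
def cuspC' (n : ℕ) [NeZero n] (u : ℝ → ℝ) (h : Euc n → Euc n) (t : ℝ) : Set (Euc n) :=
  closure (cuspS' n u h t) ∩ Metric.sphere (0 : Euc n) 1

lemma weak_type (ν : Measure ℝ) [IsFiniteMeasure ν] {a b lam : ℝ} (hlam : 0 < lam)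
    (h : 10 * (ν univ).toReal < lam * (b - a)) :
    ∃ s ∈ Icc a b, ∀ τ > 0, ν (closedBall s τ) ≤ ENNReal.ofReal (lam * τ) := by
  by_contra hcon
  push Not at hcon
  have hcon' : ∀ s : ℝ, ∃ τ : ℝ, s ∈ Icc a b → 0 < τ ∧ ENNReal.ofReal (lam * τ) < ν (closedBall s τ) := by
    intro s
    by_cases hs : s ∈ Icc a b
    · obtain ⟨τ, h1, h2⟩ := hcon s hs
      exact ⟨τ, fun _ => ⟨h1, h2⟩⟩
    · exact ⟨0, fun h => absurd h hs⟩
  choose r hr using hcon'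
  have hbd : ∀ s ∈ Icc a b, r s ≤ (ν univ).toReal / lam := by
    intro s hs
    rw [le_div_iff₀ hlam, mul_comm]
    have h1 := (hr s hs).2.le.trans (measure_mono (subset_univ _))
    exact (ENNReal.ofReal_le_iff_le_toReal (measure_ne_top _ _)).1 h1
  obtain ⟨u, hut, hdis, hcov⟩ := Vitali.exists_disjoint_subfamily_covering_enlargement_closedBall
    (Icc a b) (fun s : ℝ => s) r _ hbd 4 (by norm_num)
  have hcount : u.Countable := by
    refine hdis.countable_of_nonempty_interior ?_
    intro s hs
    refine ⟨s, ?_⟩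
    exact ball_subset_interior_closedBall (mem_ball_self (hr s (hut hs)).1)
  have hsub : Icc a b ⊆ ⋃ s ∈ u, closedBall s (4 * r s) := by
    intro s hs
    obtain ⟨c, hc, hsc⟩ := hcov s hs
    exact mem_biUnion hc (hsc (mem_closedBall_self (hr s hs).1.le))
  have h1 : ENNReal.ofReal (b - a) ≤ ∑' s : u, ENNReal.ofReal (8 * r s) := by
    calc ENNReal.ofReal (b - a) = volume (Icc a b) := by rw [Real.volume_Icc]
      _ ≤ volume (⋃ s ∈ u, closedBall s (4 * r s)) := measure_mono hsub
      _ ≤ ∑' s : u, volume (closedBall (s : ℝ) (4 * r s)) := measure_biUnion_le _ hcount _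
      _ = _ := by
        congr 1; ext s; rw [Real.volume_closedBall]; congr 1; ring
  have h2 : ENNReal.ofReal lam * ∑' s : u, ENNReal.ofReal (8 * r s) ≤ 8 * ν univ := by
    rw [← ENNReal.tsum_mul_left]
    calc _ ≤ ∑' s : u, 8 * ν (closedBall (s : ℝ) (r s)) := by
          refine ENNReal.tsum_le_tsum fun s => ?_
          have := (hr s (hut s.2)).2.le
          calc ENNReal.ofReal lam * ENNReal.ofReal (8 * r s) = 8 * ENNReal.ofReal (lam * r s) := by
                rw [← ENNReal.ofReal_mul hlam.le, show lam * (8 * r s) = 8 * (lam * r s) by ring,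
                  ENNReal.ofReal_mul (by norm_num)]
                norm_num
            _ ≤ _ := by gcongr
      _ = 8 * ν (⋃ s ∈ u, closedBall s (r s)) := by
          rw [ENNReal.tsum_mul_left, measure_biUnion hcount hdis (fun s _ => measurableSet_closedBall)]
      _ ≤ _ := by gcongr; exact subset_univ _
  have h3 : ENNReal.ofReal (lam * (b - a)) ≤ ENNReal.ofReal (8 * (ν univ).toReal) := by
    rw [ENNReal.ofReal_mul hlam.le, ENNReal.ofReal_mul (by norm_num), ENNReal.ofReal_toReal (measure_ne_top _ _)]
    calc _ ≤ _ := mul_le_mul_right h1 _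
      _ ≤ _ := h2
      _ = _ := by norm_num
  have h0 : 0 ≤ (ν univ).toReal := ENNReal.toReal_nonneg
  have := (ENNReal.ofReal_le_ofReal_iff (by positivity)).1 h3
  linarith


def scal {n : ℕ} (y : Euc n) (τ : ℝ) (w : Euc n) : Euc n := τ⁻¹ • (w - y)

def ker {n : ℕ} (k : Euc n → ℝ) (y : Euc n) (τ : ℝ) (w : Euc n) : ℝ :=
  (τ ^ n)⁻¹ * k (scal y τ w)

def dker {n : ℕ} (k : Euc n → ℝ) (y : Euc n) (τ : ℝ) (w : Euc n) : ℝ :=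
  -((τ ^ (n + 1))⁻¹ * (n * k (scal y τ w) + fderiv ℝ k (scal y τ w) (scal y τ w)))

def phi {n : ℕ} (k : Euc n → ℝ) (y : Euc n) (τ : ℝ) (j : Fin n) (w : Euc n) : ℝ :=
  (τ ^ (n + 1))⁻¹ * ((w - y) j * k (scal y τ w))

lemma ker_hasDerivAt {n : ℕ} {k : Euc n → ℝ} (hk : ContDiff ℝ ((⊤ : ℕ∞) : WithTop ℕ∞) k)
    (y w : Euc n) {τ : ℝ} (hτ : τ ≠ 0) :
    HasDerivAt (fun τ => ker k y τ w) (dker k y τ w) τ := by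
  have hd : Differentiable ℝ k := hk.differentiable (by simp)
  have h1 : HasDerivAt (fun τ : ℝ => τ⁻¹ • (w - y)) ((-(τ ^ 2)⁻¹) • (w - y)) τ :=
    (hasDerivAt_inv hτ).smul_const _
  have h2 := (hd (τ⁻¹ • (w - y))).hasFDerivAt.comp_hasDerivAt τ h1
  have h3 : HasDerivAt (fun τ : ℝ => (τ ^ n)⁻¹) (-(n * τ ^ (n - 1)) / (τ ^ n) ^ 2) τ :=
    (hasDerivAt_pow n τ).inv (pow_ne_zero _ hτ)
  have h4 := h3.mul h2
  have h5 : HasDerivAt (fun τ => ker k y τ w) _ τ := h4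
  refine h5.congr_deriv ?_
  unfold dker scal
  simp only [Function.comp, map_smul, smul_eq_mul, Pi.mul_apply]
  rcases n with _ | m
  · simp; field_simp
  · simp only [Nat.add_sub_cancel]
    field_simp
    ring

lemma phi_contDiff {n : ℕ} {k : Euc n → ℝ} (hk : ContDiff ℝ ((⊤ : ℕ∞) : WithTop ℕ∞) k)
    (y : Euc n) (τ : ℝ) (j : Fin n) :
    ContDiff ℝ ((⊤ : ℕ∞) : WithTop ℕ∞) (phi k y τ j) := by
  unfold phi scal
  have : ContDiff ℝ ((⊤ : ℕ∞) : WithTop ℕ∞) (fun w : Euc n => (w - y) j) := by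
    have h := (EuclideanSpace.proj (𝕜 := ℝ) j).contDiff (n := ((⊤ : ℕ∞) : WithTop ℕ∞))
    exact h.comp (contDiff_id.sub contDiff_const)
  have h2 : ContDiff ℝ ((⊤ : ℕ∞) : WithTop ℕ∞) (fun w : Euc n => k (τ⁻¹ • (w - y))) := 
    hk.comp (by fun_prop)
  exact contDiff_const.mul (this.mul h2)

lemma sum_phi {n : ℕ} {k : Euc n → ℝ} (hk : ContDiff ℝ ((⊤ : ℕ∞) : WithTop ℕ∞) k)
    (y w : Euc n) {τ : ℝ} :
    ∑ j, fderiv ℝ (phi k y τ j) w (EuclideanSpace.single j 1) = - dker k y τ w := by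
  have hd : Differentiable ℝ k := hk.differentiable (by simp)
  have key : ∀ j, fderiv ℝ (phi k y τ j) w (EuclideanSpace.single j 1) =
      (τ ^ (n + 1))⁻¹ * (k (scal y τ w) + fderiv ℝ k (scal y τ w) ((scal y τ w) j • EuclideanSpace.single j 1)) := by
    intro j
    have h1 : HasFDerivAt (fun w : Euc n => (w - y) j) (EuclideanSpace.proj (𝕜 := ℝ) j) w := by
      have := (EuclideanSpace.proj (𝕜 := ℝ) j : Euc n →L[ℝ] ℝ).hasFDerivAt.comp w ((hasFDerivAt_id w).sub_const y)
      rwa [ContinuousLinearMap.comp_id] at this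
    have h2 : HasFDerivAt (fun w : Euc n => scal y τ w) (τ⁻¹ • ContinuousLinearMap.id ℝ (Euc n)) w :=
      ((hasFDerivAt_id w).sub_const y).const_smul τ⁻¹
    have h3 := (hd (scal y τ w)).hasFDerivAt.comp w h2
    have h4 := (h1.mul h3).const_mul ((τ ^ (n + 1))⁻¹)
    have h5 : HasFDerivAt (phi k y τ j) _ w := h4
    rw [h5.fderiv]
    simp [scal]
    ring
  simp_rw [key]
  rw [← Finset.mul_sum, Finset.sum_add_distrib, ← map_sum]
  have : ∑ j, (scal y τ w) j • EuclideanSpace.single j (1 : ℝ) = scal y τ w := by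
    have := (EuclideanSpace.basisFun (Fin n) ℝ).sum_repr (scal y τ w)
    simpa using this
  rw [this]
  simp [dker]

lemma ker_support {n : ℕ} {k : Euc n → ℝ} {y w : Euc n} {τ : ℝ} (hτ : τ ≠ 0)
    (h : ∀ ξ ∈ tsupport k, y + τ • ξ ≠ w) : scal y τ w ∉ tsupport k := by
  intro h2
  apply h _ h2
  simp [scal, smul_smul, hτ]

lemma phi_tsupport {n : ℕ} {k : Euc n → ℝ} (hc : HasCompactSupport k) (y : Euc n) {τ : ℝ}
    (hτ : τ ≠ 0) (j : Fin n) :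
    tsupport (phi k y τ j) ⊆ (fun ξ => y + τ • ξ) '' tsupport k := by
  have hcl : IsClosed ((fun ξ => y + τ • ξ) '' tsupport k) :=
    (IsCompact.image hc (by fun_prop)).isClosed
  refine closure_minimal ?_ hcl
  intro w hw
  by_contra hcon
  apply hw
  have : scal y τ w ∉ tsupport k := by
    apply ker_support hτ
    intro ξ hξ h2
    exact hcon ⟨ξ, hξ, h2⟩
  simp [phi, image_eq_zero_of_notMem_tsupport this]


lemma intOn_aux {n : ℕ} {Ω Kc : Set (Euc n)} (hΩ : MeasurableSet Ω) (hK : IsCompact Kc) (hKΩ : Kc ⊆ Ω)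
    {v : Euc n → ℝ} (hv : ContinuousOn v Ω) (h0 : ∀ w, w ∉ Kc → v w = 0) : IntegrableOn v Ω := by
  have h1 : IntegrableOn v Kc := (hv.mono hKΩ).integrableOn_compact hK
  exact h1.of_forall_sdiff_eq_zero hΩ (fun x hx => h0 x hx.2)

lemma scal_continuous {n : ℕ} (y : Euc n) (τ : ℝ) : Continuous (scal y τ) := by
  unfold scal; fun_prop

lemma ker_continuous {n : ℕ} {k : Euc n → ℝ} (hk : Continuous k) (y : Euc n) (τ : ℝ) :
    Continuous (ker k y τ) := by
  unfold ker
  exact continuous_const.mul (hk.comp (scal_continuous y τ))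

lemma dker_continuousOn {n : ℕ} {k : Euc n → ℝ} (hk : ContDiff ℝ ((⊤ : ℕ∞) : WithTop ℕ∞) k) (y : Euc n) :
    ContinuousOn (fun q : ℝ × Euc n => dker k y q.1 q.2) {q | 0 < q.1} := by
  have hk0 : Continuous k := hk.continuous
  have hk1 : Continuous (fderiv ℝ k) := hk.continuous_fderiv (by simp)
  have hs : ContinuousOn (fun q : ℝ × Euc n => scal y q.1 q.2) {q | 0 < q.1} := by
    unfold scal
    have h1 : ContinuousOn (fun q : ℝ × Euc n => q.1⁻¹) {q | 0 < q.1} :=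
      ContinuousOn.inv₀ continuousOn_fst (fun q hq => ne_of_gt hq)
    have h2 : ContinuousOn (fun q : ℝ × Euc n => q.2 - y) {q | 0 < q.1} :=
      continuousOn_snd.sub continuousOn_const
    exact h1.smul h2
  unfold dker
  refine ContinuousOn.neg (ContinuousOn.mul (ContinuousOn.inv₀ (by fun_prop) ?_) ?_)
  · intro q hq; exact pow_ne_zero _ (ne_of_gt hq)
  · refine ContinuousOn.add (continuousOn_const.mul (hk0.comp_continuousOn hs)) ?_
    exact (hk1.comp_continuousOn hs).clm_apply hs

lemma ker_eq_zero {n : ℕ} {k : Euc n → ℝ} {y w : Euc n} {τ : ℝ} (hτ : τ ≠ 0)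
    (h : ∀ ξ ∈ tsupport k, y + τ • ξ ≠ w) : ker k y τ w = 0 := by
  simp [ker, image_eq_zero_of_notMem_tsupport (ker_support hτ h)]

lemma dker_eq_zero {n : ℕ} {k : Euc n → ℝ} {y w : Euc n} {τ : ℝ} (hτ : τ ≠ 0)
    (h : ∀ ξ ∈ tsupport k, y + τ • ξ ≠ w) : dker k y τ w = 0 := by
  have h1 := ker_support hτ h
  have h2 : fderiv ℝ k (scal y τ w) = 0 := by
    have := tsupport_fderiv_subset ℝ (f := k)
    exact image_eq_zero_of_notMem_tsupport (fun h => h1 (this h))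
  simp [dker, image_eq_zero_of_notMem_tsupport h1, h2]

lemma U_hasDerivAt {n : ℕ} {Ω : Set (Euc n)} (hΩ : IsOpen Ω) {u : Euc n → ℝ} (hu : ContinuousOn u Ω)
    {k : Euc n → ℝ} (hk : ContDiff ℝ ((⊤ : ℕ∞) : WithTop ℕ∞) k) (hc : HasCompactSupport k)
    (y : Euc n) {τ₀ : ℝ} (hτ₀ : 0 < τ₀) (hT : ∀ ξ ∈ tsupport k, y + τ₀ • ξ ∈ Ω) :
    HasDerivAt (fun τ => ∫ w in Ω, u w * ker k y τ w) (∫ w in Ω, u w * dker k y τ₀ w) τ₀ := by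
  have hc' : IsCompact (tsupport k) := hc
  have hev : ∀ᶠ τ in nhds τ₀, ∀ ξ ∈ tsupport k, y + τ • ξ ∈ Ω := by
    apply hc'.eventually_forall_of_forall_eventually
    intro ξ hξ
    have hcont : Continuous (fun z : ℝ × Euc n => y + z.1 • z.2) := by fun_prop
    exact hcont.continuousAt.eventually_mem (hΩ.mem_nhds (hT ξ hξ))
  have hev2 := hev.and (eventually_gt_nhds hτ₀)
  obtain ⟨ε, hε, hball⟩ := Metric.nhds_basis_closedBall.eventually_iff.1 hev2
  set J := closedBall τ₀ ε
  set Kc := (fun q : ℝ × Euc n => y + q.1 • q.2) '' (J ×ˢ tsupport k)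
  have hJ : IsCompact J := isCompact_closedBall _ _
  have hKc : IsCompact Kc := (hJ.prod hc').image (by fun_prop)
  have hKΩ : Kc ⊆ Ω := by
    rintro _ ⟨q, hq, rfl⟩
    exact (hball hq.1).1 _ hq.2
  have hnot : ∀ τ ∈ J, ∀ w, w ∉ Kc → ∀ ξ ∈ tsupport k, y + τ • ξ ≠ w := by
    intro τ hτ w hw ξ hξ h
    exact hw ⟨(τ, ξ), ⟨hτ, hξ⟩, h⟩
  have hcd : ContinuousOn (fun q : ℝ × Euc n => u q.2 * dker k y q.1 q.2) (J ×ˢ Kc) := by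
    refine ContinuousOn.mul (hu.comp continuousOn_snd (fun q hq => hKΩ hq.2)) ?_
    exact (dker_continuousOn hk y).mono (fun q hq => (hball hq.1).2)
  obtain ⟨C, hC⟩ := (hJ.prod hKc).exists_bound_of_continuousOn hcd
  have hτJ : τ₀ ∈ J := mem_closedBall_self hε.le
  have hdc : Continuous (dker k y τ₀) := by
    have := (dker_continuousOn hk y).comp_continuous (f := fun w : Euc n => (τ₀, w)) (by fun_prop)
      (fun _ => hτ₀)
    exact this
  refine (hasDerivAt_integral_of_dominated_loc_of_deriv_le (s := J)
    (F' := fun τ w => u w * dker k y τ w) (bound := Kc.indicator (fun _ => C))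
    (closedBall_mem_nhds _ hε) ?_ ?_ ?_ ?_ ?_ ?_).2
  · refine Filter.Eventually.of_forall fun τ => ?_
    exact (hu.mul (ker_continuous hk.continuous y τ).continuousOn).aestronglyMeasurable hΩ.measurableSet
  · refine intOn_aux hΩ.measurableSet hKc hKΩ
      (hu.mul (ker_continuous hk.continuous y τ₀).continuousOn) ?_
    intro w hw
    simp [ker_eq_zero hτ₀.ne' (hnot τ₀ hτJ w hw)]
  · exact (hu.mul hdc.continuousOn).aestronglyMeasurable hΩ.measurableSet
  · refine Filter.Eventually.of_forall fun w τ hτ => ?_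
    by_cases hw : w ∈ Kc
    · rw [indicator_of_mem hw]; exact hC (τ, w) ⟨hτ, hw⟩
    · rw [indicator_of_notMem hw, dker_eq_zero (hball hτ).2.ne' (hnot τ hτ w hw)]; simp
  · refine Integrable.integrableOn ?_
    rw [integrable_indicator_iff hKc.measurableSet]
    exact integrableOn_const hKc.measure_lt_top.ne
  · refine Filter.Eventually.of_forall fun w τ hτ => ?_
    exact (ker_hasDerivAt hk y w (hball hτ).2.ne').const_mul _

lemma dU_eq {n : ℕ} {Ω : Set (Euc n)} (hΩ : IsOpen Ω) {u : Euc n → ℝ} (hu : ContinuousOn u Ω)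
    {G : Euc n → Fin n → ℝ}
    (parts : ∀ φ : Euc n → ℝ, ContDiff ℝ ((⊤ : ℕ∞) : WithTop ℕ∞) φ → HasCompactSupport φ →
      tsupport φ ⊆ Ω → ∀ j : Fin n,
      ∫ x in Ω, u x * fderiv ℝ φ x (EuclideanSpace.single j 1) = - ∫ x in Ω, G x j * φ x)
    {k : Euc n → ℝ} (hk : ContDiff ℝ ((⊤ : ℕ∞) : WithTop ℕ∞) k) (hc : HasCompactSupport k)
    (y : Euc n) {τ : ℝ} (hτ : 0 < τ) (hT : ∀ ξ ∈ tsupport k, y + τ • ξ ∈ Ω) :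
    ∫ w in Ω, u w * dker k y τ w = ∑ j, ∫ w in Ω, G w j * phi k y τ j w := by
  have hc' : IsCompact (tsupport k) := hc
  set Kc := (fun ξ => y + τ • ξ) '' tsupport k
  have hKc : IsCompact Kc := hc'.image (by fun_prop)
  have hKΩ : Kc ⊆ Ω := by
    rintro _ ⟨ξ, hξ, rfl⟩
    exact hT _ hξ
  have hsup : ∀ j, tsupport (phi k y τ j) ⊆ Kc := fun j => phi_tsupport hc y hτ.ne' j
  have h1 : ∀ j, ∫ w in Ω, G w j * phi k y τ j w =
      - ∫ w in Ω, u w * fderiv ℝ (phi k y τ j) w (EuclideanSpace.single j 1) := by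
    intro j
    rw [parts _ (phi_contDiff hk y τ j) (hKc.of_isClosed_subset (isClosed_tsupport _) (hsup j))
      ((hsup j).trans hKΩ) j, neg_neg]
  simp_rw [h1]
  rw [Finset.sum_neg_distrib, ← integral_finsetSum, ← integral_neg]
  · congr 1; ext w
    rw [← Finset.mul_sum, sum_phi hk]; ring
  · intro j _
    refine intOn_aux hΩ.measurableSet hKc hKΩ (hu.mul ?_) ?_
    · have := (phi_contDiff hk y τ j).continuous_fderiv (by simp)
      exact (this.clm_apply continuous_const).continuousOn
    · intro w hw
      have h2 : fderiv ℝ (phi k y τ j) w = 0 :=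
        image_eq_zero_of_notMem_tsupport (fun h => hw (hsup j (tsupport_fderiv_subset ℝ h)))
      simp [h2]

lemma young_aux {X s p : ℝ} (hX : 0 ≤ X) (hs : 0 < s) (hp : 1 < p) : X ≤ s + s ^ (1 - p) * X ^ p := by
  have h0 : 0 ≤ s ^ (1 - p) * X ^ p := by positivity
  rcases le_or_gt X s with h | h
  · linarith
  · have hX' : 0 < X := hs.trans h
    have h1 : X ^ (1 - p) ≤ s ^ (1 - p) := Real.rpow_le_rpow_of_nonpos hs h.le (by linarith)
    have h2 : X = X ^ (1 - p) * X ^ p := by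
      rw [← Real.rpow_add hX']; simp
    have h3 : X ^ (1 - p) * X ^ p ≤ s ^ (1 - p) * X ^ p := by gcongr
    linarith

lemma term_bound {n : ℕ} {Ω : Set (Euc n)}
    {G : Euc n → ℝ} {X : Euc n → ℝ} {p : ℝ} (hp : 1 < p) (hX0 : ∀ x, 0 ≤ X x) (hGX : ∀ x, |G x| ≤ X x)
    (hXint : IntegrableOn (fun x => X x ^ p) Ω)
    {k : Euc n → ℝ} {R Bk : ℝ} (hR : 0 < R) (hB : ∀ ξ, |k ξ| ≤ Bk) (hkR : tsupport k ⊆ closedBall 0 R)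
    (y : Euc n) {τ M : ℝ} (hτ : 0 < τ) (hM : 0 < M)
    (hgrow : ∫ x in Ω ∩ closedBall y (R * τ), X x ^ p ≤ M * τ) (j : Fin n) :
    |∫ w in Ω, G w * phi k y τ j w| ≤
      R * Bk * ((volume (closedBall (0 : Euc n) 1)).toReal * R ^ n + 1) *
        (M ^ (1 / p) * τ ^ ((1 - (n : ℝ)) / p)) := by
  have hB0 : 0 ≤ Bk := (abs_nonneg _).trans (hB 0)
  set V := (volume (closedBall (0 : Euc n) 1)).toReal
  have hV : volume.real (closedBall y (R * τ)) = (R * τ) ^ n * V := by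
    rw [Measure.real, Measure.addHaar_closedBall' _ _ (by positivity)]
    have h0 : 0 ≤ (R * τ) ^ n := by positivity
    simp only [finrank_euclideanSpace, Fintype.card_fin, ENNReal.toReal_mul, ENNReal.toReal_ofReal h0, V]
  set s : ℝ := (M * τ ^ (1 - (n : ℝ))) ^ (1 / p) with hsdef
  have hτn : 0 < τ ^ (1 - (n : ℝ)) := Real.rpow_pos_of_pos hτ _
  have hs : 0 < s := Real.rpow_pos_of_pos (by positivity) _
  set c : ℝ := R * Bk * (τ ^ n)⁻¹ with hcdef
  have hc0 : 0 ≤ c := by positivity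
  set S := closedBall y (R * τ)
  have hSm : MeasurableSet S := measurableSet_closedBall
  have hSfin : volume S ≠ ⊤ := measure_closedBall_lt_top.ne
  have hgi : IntegrableOn (fun w => c * (s + s ^ (1 - p) * X w ^ p)) (Ω ∩ S) := by
    refine Integrable.const_mul (Integrable.add ?_ (Integrable.const_mul ?_ _)) _
    · exact integrableOn_const (ne_top_of_le_ne_top hSfin (measure_mono inter_subset_right))
    · exact hXint.mono_set inter_subset_left
  have hpt : ∀ w, ‖G w * phi k y τ j w‖ ≤ S.indicator (fun w => c * (s + s ^ (1 - p) * X w ^ p)) w := by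
    intro w
    by_cases hw : w ∈ S
    · rw [indicator_of_mem hw, norm_mul, Real.norm_eq_abs, Real.norm_eq_abs]
      have h1 : |phi k y τ j w| ≤ c := by
        unfold phi
        rw [abs_mul, abs_mul, abs_of_pos (by positivity : 0 < (τ ^ (n + 1))⁻¹)]
        have h2 : |(w - y) j| ≤ R * τ := by
          have := PiLp.norm_apply_le (w - y) j
          rw [Real.norm_eq_abs] at this
          refine this.trans ?_
          rw [← dist_eq_norm]; exact hw
        calc (τ ^ (n + 1))⁻¹ * (|(w - y) j| * |k (scal y τ w)|)
            ≤ (τ ^ (n + 1))⁻¹ * ((R * τ) * Bk) := by gcongr; exact hB _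
          _ = c := by rw [hcdef, pow_succ]; field_simp
      calc |G w| * |phi k y τ j w| ≤ X w * c := by gcongr; exacts [hX0 w, hGX w]
        _ = c * X w := mul_comm _ _
        _ ≤ _ := by gcongr; exact young_aux (hX0 w) hs hp
    · rw [indicator_of_notMem hw]
      have : phi k y τ j w = 0 := by
        have h3 : scal y τ w ∉ tsupport k := by
          apply ker_support hτ.ne'
          intro ξ hξ h
          apply hw
          have := hkR hξ
          rw [mem_closedBall_zero_iff] at this
          rw [← h]
          simp only [S, mem_closedBall, dist_eq_norm, add_sub_cancel_left, norm_smul, Real.norm_eq_abs, abs_of_pos hτ]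
          nlinarith
        simp [phi, image_eq_zero_of_notMem_tsupport h3]
      simp [this]
  have h1 := norm_integral_le_of_norm_le (μ := volume.restrict Ω)
    (g := S.indicator (fun w => c * (s + s ^ (1 - p) * X w ^ p)))
    (by rw [integrable_indicator_iff hSm, IntegrableOn, Measure.restrict_restrict hSm, inter_comm]; exact hgi)
    (Filter.Eventually.of_forall hpt)
  rw [Real.norm_eq_abs] at h1
  refine h1.trans ?_
  have hi1 : Integrable (fun _ : Euc n => s) (volume.restrict (Ω ∩ S)) :=
    integrableOn_const (ne_top_of_le_ne_top hSfin (measure_mono inter_subset_right))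
  have hi2 : Integrable (fun w => s ^ (1 - p) * X w ^ p) (volume.restrict (Ω ∩ S)) :=
    Integrable.const_mul (hXint.mono_set inter_subset_left) _
  rw [integral_indicator hSm, Measure.restrict_restrict hSm, inter_comm, integral_const_mul,
    integral_add hi1 hi2, integral_const_mul, setIntegral_const]
  have h2 : volume.real (Ω ∩ S) ≤ (R * τ) ^ n * V := by
    rw [← hV]; exact measureReal_mono inter_subset_right hSfin
  have hs1 : s = M ^ (1 / p) * τ ^ ((1 - (n : ℝ)) / p) := by
    rw [hsdef, Real.mul_rpow hM.le hτn.le, ← Real.rpow_mul hτ.le]; congr 2; ring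
  have hs2 : s ^ (1 - p) * (M * τ) = s * τ ^ n := by
    have : s ^ p = M * τ ^ (1 - (n : ℝ)) := by
      rw [hsdef, ← Real.rpow_mul (by positivity)]; simp [(by linarith : p ≠ 0)]
    rw [Real.rpow_sub hs, Real.rpow_one, this, Real.rpow_sub hτ, Real.rpow_one, Real.rpow_natCast]
    field_simp
  rw [← hs1]
  calc c * (volume.real (Ω ∩ S) • s + s ^ (1 - p) * ∫ x in Ω ∩ S, X x ^ p)
      ≤ c * ((R * τ) ^ n * V * s + s ^ (1 - p) * (M * τ)) := by
        rw [smul_eq_mul]; gcongr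
    _ = R * Bk * (V * R ^ n + 1) * s := by
        rw [hs2, hcdef, mul_pow]; field_simp


lemma ker_integral {n : ℕ} {k : Euc n → ℝ} (h1 : ∫ ξ, k ξ = 1) (y : Euc n) {τ : ℝ} (hτ : 0 < τ) :
    ∫ w, ker k y τ w = 1 := by
  unfold ker scal
  rw [integral_const_mul, integral_sub_right_eq_self (fun w => k (τ⁻¹ • w)) y,
    Measure.integral_comp_inv_smul, h1]
  simp only [finrank_euclideanSpace, Fintype.card_fin, smul_eq_mul, mul_one]
  rw [abs_of_pos (by positivity)]
  field_simp

lemma U_tendsto {n : ℕ} {Ω : Set (Euc n)} (hΩ : IsOpen Ω) {u : Euc n → ℝ} (hu : ContinuousOn u Ω)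
    {k : Euc n → ℝ} (hk : Continuous k) (hk0 : ∀ ξ, 0 ≤ k ξ) (hk1 : ∫ ξ, k ξ = 1)
    {R : ℝ} (hR : 0 < R) (hkR : tsupport k ⊆ closedBall 0 R)
    {y : Euc n} (hy : y ∈ Ω) {ρ : ℝ} (hρ : 0 < ρ)
    (hT : ∀ τ ∈ Ioc 0 ρ, ∀ ξ ∈ tsupport k, y + τ • ξ ∈ Ω) :
    Filter.Tendsto (fun τ => ∫ w in Ω, u w * ker k y τ w) (nhdsWithin 0 (Ioi 0)) (nhds (u y)) := by
  have hc : IsCompact (tsupport k) := (isCompact_closedBall _ _).of_isClosed_subset (isClosed_tsupport _) hkR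
  rw [Metric.tendsto_nhds]
  intro ε hε
  have hcont : ContinuousAt u y := hu.continuousAt (hΩ.mem_nhds hy)
  obtain ⟨δ, hδ, hball⟩ := Metric.continuousAt_iff.1 hcont (ε / 2) (by positivity)
  have hlt : ∀ᶠ τ in nhdsWithin (0 : ℝ) (Ioi 0), τ < min ρ (δ / R) :=
    nhdsWithin_le_nhds (eventually_lt_nhds (by positivity))
  filter_upwards [hlt, self_mem_nhdsWithin] with τ hτ hτ0
  have hτ0 : 0 < τ := hτ0
  have hτρ : τ < ρ := hτ.trans_le (min_le_left _ _)
  have hτδ : R * τ < δ := by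
    have := hτ.trans_le (min_le_right _ _)
    rwa [lt_div_iff₀ hR, mul_comm] at this
  set Kc := (fun ξ => y + τ • ξ) '' tsupport k
  have hKc : IsCompact Kc := hc.image (by fun_prop)
  have hKΩ : Kc ⊆ Ω := by
    rintro _ ⟨ξ, hξ, rfl⟩
    exact hT τ ⟨hτ0, hτρ.le⟩ _ hξ
  have hz : ∀ w, w ∉ Kc → ker k y τ w = 0 := fun w hw =>
    ker_eq_zero hτ0.ne' (fun ξ hξ h => hw ⟨ξ, hξ, h⟩)
  have hker0 : ∀ w, 0 ≤ ker k y τ w := fun w => by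
    unfold ker; exact mul_nonneg (by positivity) (hk0 _)
  have i1 : IntegrableOn (ker k y τ) Ω := intOn_aux hΩ.measurableSet hKc hKΩ
    (ker_continuous hk y τ).continuousOn hz
  have i2 : IntegrableOn (fun w => u w * ker k y τ w) Ω := intOn_aux hΩ.measurableSet hKc hKΩ
    (hu.mul (ker_continuous hk y τ).continuousOn) (fun w hw => by simp [hz w hw])
  have e1 : ∫ w in Ω, ker k y τ w = 1 := by
    rw [setIntegral_eq_integral_of_forall_compl_eq_zero, ker_integral hk1 y hτ0]
    intro w hw; exact hz w (fun h => hw (hKΩ h))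
  have e2 : (∫ w in Ω, u w * ker k y τ w) - u y = ∫ w in Ω, (u w * ker k y τ w - u y * ker k y τ w) := by
    rw [integral_sub i2 (i1.const_mul _), integral_const_mul, e1, mul_one]
  rw [Real.dist_eq, e2, ← Real.norm_eq_abs]
  have hb : ‖∫ w in Ω, (u w * ker k y τ w - u y * ker k y τ w)‖ ≤ ∫ w in Ω, ε / 2 * ker k y τ w := by
    refine norm_integral_le_of_norm_le (i1.const_mul _) (Filter.Eventually.of_forall fun w => ?_)
    by_cases hw : w ∈ Kc
    · rw [← sub_mul, norm_mul, Real.norm_of_nonneg (hker0 w)]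
      refine mul_le_mul_of_nonneg_right ?_ (hker0 w)
      obtain ⟨ξ, hξ, rfl⟩ := hw
      have h3 := hkR hξ
      rw [mem_closedBall_zero_iff] at h3
      have : dist (y + τ • ξ) y < δ := by
        simp only [dist_eq_norm, add_sub_cancel_left, norm_smul, Real.norm_eq_abs, abs_of_pos hτ0]
        nlinarith
      exact (hball this).le
    · simp [hz w hw]
  rw [integral_const_mul, e1] at hb
  linarith

lemma osc_kernel {n : ℕ} {Ω : Set (Euc n)} (hΩ : IsOpen Ω) {u : Euc n → ℝ} (hu : ContinuousOn u Ω)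
    {G : Euc n → Fin n → ℝ}
    (parts : ∀ φ : Euc n → ℝ, ContDiff ℝ ((⊤ : ℕ∞) : WithTop ℕ∞) φ → HasCompactSupport φ →
      tsupport φ ⊆ Ω → ∀ j : Fin n,
      ∫ x in Ω, u x * fderiv ℝ φ x (EuclideanSpace.single j 1) = - ∫ x in Ω, G x j * φ x)
    {X : Euc n → ℝ} {p : ℝ} (hp : 1 < p) (hpn : (n : ℝ) - 1 < p)
    (hX0 : ∀ x, 0 ≤ X x) (hGX : ∀ x j, |G x j| ≤ X x)
    (hXint : IntegrableOn (fun x => X x ^ p) Ω)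
    {k : Euc n → ℝ} (hk : ContDiff ℝ ((⊤ : ℕ∞) : WithTop ℕ∞) k)
    (hk0 : ∀ ξ, 0 ≤ k ξ) (hk1 : ∫ ξ, k ξ = 1)
    {R Bk : ℝ} (hR : 0 < R) (hB : ∀ ξ, |k ξ| ≤ Bk) (hkR : tsupport k ⊆ closedBall 0 R)
    {y : Euc n} (hy : y ∈ Ω) {ρ : ℝ} (hρ : 0 < ρ)
    (hT : ∀ τ ∈ Ioc 0 ρ, ∀ ξ ∈ tsupport k, y + τ • ξ ∈ Ω)
    {M : ℝ} (hM : 0 < M)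
    (hgrow : ∀ τ ∈ Ioc 0 ρ, ∫ x in Ω ∩ closedBall y (R * τ), X x ^ p ≤ M * τ) :
    |(∫ w in Ω, u w * ker k y ρ w) - u y| ≤
      n * (R * Bk * ((volume (closedBall (0 : Euc n) 1)).toReal * R ^ n + 1)) / (1 + (1 - (n : ℝ)) / p) *
        (M ^ (1 / p) * ρ ^ (1 + (1 - (n : ℝ)) / p)) := by
  have hc : HasCompactSupport k :=
    (isCompact_closedBall _ _).of_isClosed_subset (isClosed_tsupport _) hkR
  set γ : ℝ := 1 + (1 - (n : ℝ)) / p with hγ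
  have hγ0 : 0 < γ := by
    have hp0 : 0 < p := by linarith
    have : γ = (p - (n - 1)) / p := by rw [hγ]; field_simp; ring
    rw [this]; apply div_pos <;> linarith
  have hB0 : 0 ≤ Bk := (abs_nonneg _).trans (hB 0)
  set C0 : ℝ := R * Bk * ((volume (closedBall (0 : Euc n) 1)).toReal * R ^ n + 1) with hC0
  have hC00 : 0 ≤ C0 := by positivity
  set C : ℝ := n * C0 * M ^ (1 / p) with hC
  set U := fun τ => ∫ w in Ω, u w * ker k y τ w with hU
  set dU := fun τ => ∫ w in Ω, u w * dker k y τ w with hdU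
  have hder : ∀ τ ∈ Ioc 0 ρ, HasDerivAt U (dU τ) τ := fun τ hτ =>
    U_hasDerivAt hΩ hu hk hc y hτ.1 (hT τ hτ)
  have hbd : ∀ τ ∈ Ioc 0 ρ, |dU τ| ≤ C * τ ^ (γ - 1) := by
    intro τ hτ
    simp only [hdU]
    rw [dU_eq hΩ hu parts hk hc y hτ.1 (hT τ hτ)]
    calc _ ≤ ∑ j, |∫ w in Ω, G w j * phi k y τ j w| := Finset.abs_sum_le_sum_abs _ _
      _ ≤ ∑ j : Fin n, C0 * (M ^ (1 / p) * τ ^ ((1 - (n : ℝ)) / p)) := by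
        refine Finset.sum_le_sum fun j _ => ?_
        exact term_bound hp hX0 (fun x => hGX x j) hXint hR hB hkR y hτ.1 hM (hgrow τ hτ) j
      _ = _ := by
        rw [Finset.sum_const, Finset.card_univ, Fintype.card_fin, nsmul_eq_mul, hC, hγ]
        rw [add_sub_cancel_left]; ring
  have hW : ∀ τ ∈ Ioc 0 ρ, HasDerivAt (fun τ : ℝ => C / γ * τ ^ γ) (C * τ ^ (γ - 1)) τ := by
    intro τ hτ
    have := (Real.hasDerivAt_rpow_const (x := τ) (p := γ) (Or.inl hτ.1.ne')).const_mul (C / γ)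
    refine this.congr_deriv ?_
    field_simp
  have mono1 : MonotoneOn (fun τ => C / γ * τ ^ γ - U τ) (Ioc 0 ρ) := by
    refine monotoneOn_of_deriv_nonneg (convex_Ioc _ _) ?_ ?_ ?_
    · exact fun τ hτ => ((hW τ hτ).sub (hder τ hτ)).continuousAt.continuousWithinAt
    · exact fun τ hτ => ((hW τ (interior_subset hτ)).sub (hder τ (interior_subset hτ))).differentiableAt.differentiableWithinAt
    · intro τ hτ
      have hτ := interior_subset hτ
      have h5 : HasDerivAt (fun τ => C / γ * τ ^ γ - U τ) _ τ := (hW τ hτ).sub (hder τ hτ)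
      rw [h5.deriv]
      linarith [(abs_le.1 (hbd τ hτ)).2]
  have mono2 : MonotoneOn (fun τ => C / γ * τ ^ γ + U τ) (Ioc 0 ρ) := by
    refine monotoneOn_of_deriv_nonneg (convex_Ioc _ _) ?_ ?_ ?_
    · exact fun τ hτ => ((hW τ hτ).add (hder τ hτ)).continuousAt.continuousWithinAt
    · exact fun τ hτ => ((hW τ (interior_subset hτ)).add (hder τ (interior_subset hτ))).differentiableAt.differentiableWithinAt
    · intro τ hτ
      have hτ := interior_subset hτ
      have h5 : HasDerivAt (fun τ => C / γ * τ ^ γ + U τ) _ τ := (hW τ hτ).add (hder τ hτ)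
      rw [h5.deriv]
      linarith [(abs_le.1 (hbd τ hτ)).1]
  have hfin : ∀ᶠ τ in nhdsWithin (0 : ℝ) (Ioi 0), |U ρ - U τ| ≤ C / γ * ρ ^ γ := by
    have hlt : ∀ᶠ τ in nhdsWithin (0 : ℝ) (Ioi 0), τ < ρ :=
      nhdsWithin_le_nhds (eventually_lt_nhds hρ)
    filter_upwards [hlt, self_mem_nhdsWithin] with τ hτ hτ0
    have hτ0 : 0 < τ := hτ0
    have a1 := mono1 ⟨hτ0, hτ.le⟩ ⟨hρ, le_rfl⟩ hτ.le
    have a2 := mono2 ⟨hτ0, hτ.le⟩ ⟨hρ, le_rfl⟩ hτ.le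
    simp only at a1 a2
    have : 0 ≤ C / γ * τ ^ γ := by positivity
    rw [abs_le]; constructor <;> linarith
  have htend := U_tendsto hΩ hu hk.continuous hk0 hk1 hR hkR hy hρ hT
  have h6 : |U ρ - u y| ≤ C / γ * ρ ^ γ :=
    le_of_tendsto (tendsto_const_nhds.sub htend).abs hfin
  refine h6.trans (le_of_eq ?_)
  rw [hC]; ring

/-- a fixed bump -/
def psi (n : ℕ) : Euc n → ℝ :=
  (⟨1/2, 1, by norm_num, by norm_num⟩ : ContDiffBump (0 : Euc n)).normed volume

def avg {n : ℕ} (Ω : Set (Euc n)) (u : Euc n → ℝ) (z : Euc n) (ρ : ℝ) : ℝ :=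
  ∫ w in Ω, u w * ker (psi n) z ρ w

lemma psi_bound (n : ℕ) : ∃ B, ∀ ξ : Euc n, |psi n ξ| ≤ B := by
  have h1 : Continuous (psi n) := ContDiffBump.continuous_normed _
  have h2 : HasCompactSupport (psi n) := ContDiffBump.hasCompactSupport_normed _
  obtain ⟨C, hC⟩ := h2.exists_bound_of_continuous h1
  exact ⟨C, hC⟩

theorem osc_main (n : ℕ) (p A : ℝ) (hp : 1 < p) (hpn : (n : ℝ) - 1 < p) (hA : 0 ≤ A) :
    ∃ C : ℝ, 0 < C ∧ ∀ (Ω : Set (Euc n)) (g : Euc n → Euc n) (Dg : Euc n → Matrix (Fin n) (Fin n) ℝ),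
      IsOpen Ω → ContinuousOn g Ω → MemSobolev p Ω g Dg → ∀ (i : Fin n) (Q : Set (Euc n)) (y z : Euc n)
        (ρ M : ℝ), Convex ℝ Q → Q ⊆ Ω → y ∈ Q → closedBall z ρ ⊆ Q → dist z y ≤ A * ρ → 0 < ρ → 0 < M →
        (∀ τ ∈ Ioc 0 ρ, ∫ x in Ω ∩ closedBall y ((A + 1) * τ), opNorm (Dg x) ^ p ≤ M * τ) →
        |avg Ω (fun x => g x i) z ρ - g y i| ≤ C * (M ^ (1 / p) * ρ ^ (1 + (1 - (n : ℝ)) / p)) := by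
  obtain ⟨B, hB⟩ := psi_bound n
  set C1 := n * ((A + 1) * B * ((volume (closedBall (0 : Euc n) 1)).toReal * (A + 1) ^ n + 1)) / (1 + (1 - (n : ℝ)) / p)
  refine ⟨|C1| + 1, by positivity, ?_⟩
  intro Ω g Dg hΩ hg hS i Q y z ρ M hQ hQΩ hyQ hzQ hzy hρ hM hgrow
  set v : Euc n := ρ⁻¹ • (z - y) with hv
  set k : Euc n → ℝ := fun ξ => psi n (ξ - v) with hkdef
  have hψ : ContDiff ℝ ((⊤ : ℕ∞) : WithTop ℕ∞) (psi n) := ContDiffBump.contDiff_normed _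
  have hk : ContDiff ℝ ((⊤ : ℕ∞) : WithTop ℕ∞) k := hψ.comp (by fun_prop)
  have hψs : tsupport (psi n) = closedBall 0 1 := ContDiffBump.tsupport_normed_eq _
  have hks : tsupport k ⊆ closedBall v 1 := by
    refine closure_minimal ?_ isClosed_closedBall
    intro ξ hξ
    have h1 : ξ - v ∈ tsupport (psi n) := subset_tsupport _ hξ
    rw [hψs, mem_closedBall_zero_iff] at h1
    rw [mem_closedBall, dist_eq_norm]; exact h1
  have hvA : ‖v‖ ≤ A := by
    rw [hv, norm_smul, norm_inv, Real.norm_of_nonneg hρ.le, inv_mul_le_iff₀ hρ, ← dist_eq_norm, mul_comm]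
    exact hzy
  have hkR : tsupport k ⊆ closedBall 0 (A + 1) := by
    intro ξ hξ
    have h1 := hks hξ
    rw [mem_closedBall, dist_eq_norm] at h1
    rw [mem_closedBall_zero_iff]
    have := norm_add_le (ξ - v) v
    rw [sub_add_cancel] at this
    linarith
  have hT : ∀ τ ∈ Ioc 0 ρ, ∀ ξ ∈ tsupport k, y + τ • ξ ∈ Ω := by
    intro τ hτ ξ hξ
    apply hQΩ
    have h1 := hks hξ
    rw [mem_closedBall, dist_eq_norm] at h1
    have h2 : z + ρ • (ξ - v) ∈ Q := by
      apply hzQ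
      rw [mem_closedBall, dist_eq_norm, add_sub_cancel_left, norm_smul, Real.norm_of_nonneg hρ.le]
      nlinarith
    have h3 := hQ hyQ h2 (a := 1 - τ / ρ) (b := τ / ρ) (by rw [sub_nonneg, div_le_one hρ]; exact hτ.2)
      (by have := hτ.1; positivity) (by ring)
    convert h3 using 1
    rw [hv]
    simp only [smul_sub, smul_add, smul_smul, sub_smul, one_smul]
    have e1 : ρ * ρ⁻¹ = 1 := by field_simp
    have e2 : τ / ρ * ρ = τ := by field_simp
    have e3 : τ / ρ * (ρ * ρ⁻¹) = τ / ρ := by rw [e1, mul_one]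
    rw [e3, e2]
    abel
  have hopn : ∀ x j, |Dg x i j| ≤ opNorm (Dg x) := by
    intro x j
    have h1 := (LinearMap.toContinuousLinearMap (Matrix.toEuclideanLin (Dg x))).le_opNorm (EuclideanSpace.single j 1)
    have h2 := PiLp.norm_apply_le ((LinearMap.toContinuousLinearMap (Matrix.toEuclideanLin (Dg x))) (EuclideanSpace.single j 1)) i
    have h3 : ((LinearMap.toContinuousLinearMap (Matrix.toEuclideanLin (Dg x))) (EuclideanSpace.single j 1)) i = Dg x i j := by
      simp
    rw [h3] at h2
    simp only [PiLp.norm_single, norm_one, mul_one] at h1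
    exact h2.trans h1
  have hu : ContinuousOn (fun x => g x i) Ω :=
    (EuclideanSpace.proj (𝕜 := ℝ) i : Euc n →L[ℝ] ℝ).continuous.comp_continuousOn hg
  have main := osc_kernel hΩ hu (G := fun x j => Dg x i j)
    (fun φ h1 h2 h3 j => hS.parts φ h1 h2 h3 i j) hp hpn (fun x => norm_nonneg _) hopn hS.lp hk
    (fun ξ => ContDiffBump.nonneg_normed _ _)
    (by rw [hkdef, integral_sub_right_eq_self (fun w => psi n w) v]; exact ContDiffBump.integral_normed _)
    (by linarith : 0 < A + 1) (fun ξ => hB _) hkR (hQΩ hyQ) hρ hT hM hgrow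
  have e : avg Ω (fun x => g x i) z ρ = ∫ w in Ω, g w i * ker k y ρ w := by
    unfold avg
    congr 1; ext w; congr 1
    simp only [ker, scal, hkdef, hv]
    congr 2
    rw [← smul_sub]; congr 1; abel
  rw [e]
  refine main.trans ?_
  gcongr
  exact (le_abs_self C1).trans (by linarith)


lemma good_level {n : ℕ} {S : Set (Euc n)} {F : Euc n → ℝ} (hF0 : ∀ x, 0 ≤ F x)
    (hF : IntegrableOn F S) {pr : Euc n → ℝ} (hpr : LipschitzWith 1 pr)
    {a b lam : ℝ} (hlam : 0 < lam) (h : 10 * (∫ x in S, F x) < lam * (b - a)) :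
    ∃ s ∈ Icc a b, ∀ τ > 0, ∀ y, pr y = s → ∫ x in S ∩ closedBall y τ, F x ≤ lam * τ := by
  set μ := (volume.restrict S).withDensity (fun x => ENNReal.ofReal (F x)) with hμ
  have hmeas : Measurable pr := hpr.continuous.measurable
  have hu : μ univ = ENNReal.ofReal (∫ x in S, F x) := by
    rw [hμ, withDensity_apply _ MeasurableSet.univ, Measure.restrict_univ,
      ofReal_integral_eq_lintegral_ofReal hF (Filter.Eventually.of_forall hF0)]
  have : IsFiniteMeasure μ := ⟨by rw [hu]; exact ENNReal.ofReal_lt_top⟩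
  have hI0 : 0 ≤ ∫ x in S, F x := integral_nonneg hF0
  obtain ⟨s, hs, hgood⟩ := weak_type (μ.map pr) (a := a) (b := b) hlam (by
    rw [Measure.map_apply hmeas MeasurableSet.univ, preimage_univ, hu, ENNReal.toReal_ofReal hI0]
    exact h)
  refine ⟨s, hs, fun τ hτ y hy => ?_⟩
  have h1 := hgood τ hτ
  rw [Measure.map_apply hmeas measurableSet_closedBall] at h1
  have hsub : closedBall y τ ⊆ pr ⁻¹' closedBall s τ := by
    intro x hx
    rw [mem_preimage, mem_closedBall, ← hy]
    have := hpr.dist_le_mul x y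
    simp only [NNReal.coe_one, one_mul] at this
    exact this.trans hx
  have h2 : μ (closedBall y τ) ≤ ENNReal.ofReal (lam * τ) := (measure_mono hsub).trans h1
  rw [hμ, withDensity_apply _ measurableSet_closedBall,
    Measure.restrict_restrict measurableSet_closedBall, inter_comm,
    ← ofReal_integral_eq_lintegral_ofReal (hF.mono_set inter_subset_left) (Filter.Eventually.of_forall hF0)] at h2
  exact (ENNReal.ofReal_le_ofReal_iff (by positivity)).1 h2

def sliceSet (n : ℕ) [NeZero n] (t : ℝ) : Set (Euc n) := {y | y 0 = t ∧ y ≠ EuclideanSpace.single 0 t}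

lemma curve_tendsto {n : ℕ} [NeZero n] (t : ℝ) (i : Fin n) (hi : i ≠ 0) :
    Filter.Tendsto (fun ε : ℝ => (EuclideanSpace.single 0 t + EuclideanSpace.single i ε : Euc n))
      (nhdsWithin 0 (Ioi 0)) (nhdsWithin (EuclideanSpace.single 0 t) (sliceSet n t)) := by
  refine tendsto_nhdsWithin_iff.2 ⟨?_, ?_⟩
  · have hc : Continuous (fun ε : ℝ => (EuclideanSpace.single 0 t + EuclideanSpace.single i ε : Euc n)) := by
      have : (fun ε : ℝ => (EuclideanSpace.single i ε : Euc n)) = fun ε => ε • EuclideanSpace.single i (1 : ℝ) := by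
        ext ε j; simp
      have h2 : Continuous (fun ε : ℝ => (EuclideanSpace.single i ε : Euc n)) := by rw [this]; fun_prop
      exact continuous_const.add h2
    have := hc.tendsto 0
    have h0 : (EuclideanSpace.single i 0 : Euc n) = 0 := by ext j; simp
    simp only [h0, add_zero] at this
    exact this.mono_left nhdsWithin_le_nhds
  · filter_upwards [self_mem_nhdsWithin] with ε hε
    have hε : 0 < ε := hε
    refine ⟨by simp [hi.symm], fun h => ?_⟩
    have := congrArg (fun v : Euc n => v i) h
    simp [hi] at this
    exact hε.ne' this

lemma slit_open {n : ℕ} [NeZero n] : IsOpen (unitBall n \ slit n) := by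
  have : unitBall n \ slit n = unitBall n ∩ {p : Euc n | 0 ≤ p 0 ∧ ∀ i : Fin n, i ≠ 0 → p i = 0}ᶜ := by
    ext x
    simp only [unitBall, slit, mem_sdiff, mem_inter_iff, mem_compl_iff, mem_ofPred_eq, mem_ball_zero_iff]
    constructor
    · rintro ⟨h1, h2⟩
      refine ⟨h1, fun h3 => h2 ⟨h3.1, ?_, h3.2⟩⟩
      have := PiLp.norm_apply_le x 0
      rw [Real.norm_eq_abs] at this
      linarith [le_abs_self (x 0)]
    · rintro ⟨h1, h2⟩
      exact ⟨h1, fun h3 => h2 ⟨h3.1, h3.2.2⟩⟩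
  rw [this]
  refine isOpen_ball.inter (isOpen_compl_iff.2 ?_)
  simp only [ofPred_and, ofPred_forall]
  refine IsClosed.inter (isClosed_le continuous_const (by fun_prop)) ?_
  refine isClosed_iInter fun i => isClosed_iInter fun _ => isClosed_eq (by fun_prop) continuous_const

lemma slice_limit {n : ℕ} [NeZero n] (hn : 3 ≤ n) (p : ℝ) (hp : (n : ℝ) - 1 < p)
    {f : Euc n → Euc n} {Df : Euc n → Matrix (Fin n) (Fin n) ℝ}
    (hf : ContinuousOn f (unitBall n \ slit n)) (hS : MemSobolev p (unitBall n \ slit n) f Df)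
    {t lam : ℝ} (ht0 : 0 < t) (ht1 : t < 1 / 2) (hlam : 0 < lam)
    (hgrow : ∀ τ > 0, ∀ y : Euc n, y 0 = t →
      ∫ x in (unitBall n \ slit n) ∩ closedBall y τ, opNorm (Df x) ^ p ≤ lam * τ) :
    ∃ c, Filter.Tendsto f (nhdsWithin (EuclideanSpace.single 0 t) (sliceSet n t)) (nhds c) := by
  have hn3 : (3 : ℝ) ≤ n := by exact_mod_cast hn
  have hp1 : 1 < p := by linarith
  obtain ⟨C, hC, hosc⟩ := osc_main n p 3 hp1 hp (by norm_num)
  set P : Euc n := EuclideanSpace.single 0 t with hP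
  set γ : ℝ := 1 + (1 - (n : ℝ)) / p with hγ
  have hγ0 : 0 < γ := by
    have hp0 : 0 < p := by linarith
    have : γ = (p - (n - 1)) / p := by rw [hγ]; field_simp; ring
    rw [this]; apply div_pos <;> linarith
  set E : ℝ → ℝ := fun ρ => C * ((4 * lam) ^ (1 / p) * ρ ^ γ) with hE
  have hPn : ‖P‖ = t := by rw [hP, PiLp.norm_single, Real.norm_of_nonneg ht0.le]
  have step : ∀ ρ, 0 < ρ → ρ < 1 / 20 → ∀ j i : Fin n, i ≠ 0 → ∀ σ : ℝ, |σ| = 1 → ∀ y : Euc n, y 0 = t →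
      ‖y - P‖ ≤ ρ → 0 < σ * y i →
      |avg (unitBall n \ slit n) (fun x => f x j) (P + EuclideanSpace.single i (2 * ρ * σ)) ρ - f y j| ≤ E ρ := by
    intro ρ hρ hρ1 j i hi σ hσ y hy0 hyP hyi
    have hσ2 : σ * σ = 1 := by rw [← abs_mul_abs_self, hσ]; norm_num
    set z : Euc n := P + EuclideanSpace.single i (2 * ρ * σ) with hz
    have hsn : ‖(EuclideanSpace.single i (2 * ρ * σ) : Euc n)‖ = 2 * ρ := by
      rw [PiLp.norm_single, Real.norm_eq_abs, abs_mul, hσ, abs_of_pos (by positivity), mul_one]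
    have hzn : ‖z‖ ≤ t + 2 * ρ := by
      rw [hz]; refine (norm_add_le _ _).trans ?_; rw [hPn, hsn]
    have hyn : ‖y‖ ≤ t + ρ := by
      have := norm_add_le (y - P) P
      rw [sub_add_cancel, hPn] at this; linarith
    refine hosc _ f Df slit_open hf hS j (unitBall n ∩ {w : Euc n | 0 < σ * w i}) y z ρ (4 * lam) ?_ ?_ ?_ ?_ ?_ hρ
      (by positivity) ?_
    · refine (convex_ball _ _).inter ?_
      have hl : IsLinearMap ℝ (fun w : Euc n => σ * w i) :=
        ⟨fun a b => by simp [mul_add], fun a b => by simp; ring⟩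
      exact convex_halfSpace_gt hl 0
    · rintro w ⟨hw1, hw2⟩
      refine ⟨hw1, fun hw3 => ?_⟩
      have := hw3.2.2 i hi
      simp [this] at hw2
    · refine ⟨?_, hyi⟩
      rw [unitBall, mem_ball_zero_iff]; linarith
    · intro w hw
      rw [mem_closedBall, dist_eq_norm] at hw
      constructor
      · rw [unitBall, mem_ball_zero_iff]
        have := norm_add_le (w - z) z
        rw [sub_add_cancel] at this; linarith
      · have h1 := (PiLp.norm_apply_le (w - z) i).trans hw
        rw [Real.norm_eq_abs] at h1
        have h2 : (w - z) i = w i - 2 * ρ * σ := by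
          simp [hz, hP, hi]
        rw [h2] at h1
        have h3 : |σ * (w i - 2 * ρ * σ)| ≤ ρ := by rw [abs_mul, hσ, one_mul]; exact h1
        have h4 := (abs_le.1 h3).1
        show 0 < σ * w i
        nlinarith
    · rw [dist_eq_norm]
      have : z - y = -(y - P) + EuclideanSpace.single i (2 * ρ * σ) := by rw [hz]; abel
      rw [this]
      refine (norm_add_le _ _).trans ?_
      rw [norm_neg, hsn]; linarith
    · intro τ hτ
      have := hgrow ((3 + 1) * τ) (by have := hτ.1; linarith) y hy0
      linarith
  have hEnn : ∀ ρ, 0 < ρ → 0 ≤ E ρ := fun ρ hρ => by simp only [hE]; positivity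
  have pair1 : ∀ ρ, 0 < ρ → ρ < 1 / 20 → ∀ j i i' : Fin n, i ≠ 0 → i' ≠ 0 → i ≠ i' → ∀ y y' : Euc n,
      y 0 = t → y' 0 = t → ‖y - P‖ ≤ ρ → ‖y' - P‖ ≤ ρ → y i ≠ 0 → y' i' ≠ 0 → |f y j - f y' j| ≤ 4 * E ρ := by
    intro ρ hρ hρ1 j i i' hi hi' hii y y' hy hy' hyP hyP' hyi hyi'
    have sg : ∀ x : ℝ, x ≠ 0 → ∃ σ : ℝ, |σ| = 1 ∧ 0 < σ * x := by
      intro x hx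
      rcases lt_or_gt_of_ne hx with h | h
      · exact ⟨-1, by simp, by linarith⟩
      · exact ⟨1, by simp, by linarith⟩
    obtain ⟨σ, hσ, hs⟩ := sg _ hyi
    obtain ⟨σ', hσ', hs'⟩ := sg _ hyi'
    have hσ2 : σ * σ = 1 := by rw [← abs_mul_abs_self, hσ]; norm_num
    have hσ2' : σ' * σ' = 1 := by rw [← abs_mul_abs_self, hσ']; norm_num
    set w : Euc n := P + (EuclideanSpace.single i (ρ / 2 * σ) + EuclideanSpace.single i' (ρ / 2 * σ')) with hw
    have hw0 : w 0 = t := by simp [hw, hP, hi.symm, hi'.symm]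
    have hwP : ‖w - P‖ ≤ ρ := by
      rw [hw, add_sub_cancel_left]
      refine (norm_add_le _ _).trans ?_
      rw [PiLp.norm_single, PiLp.norm_single, Real.norm_eq_abs, Real.norm_eq_abs, abs_mul, abs_mul, hσ, hσ',
        abs_of_pos (by positivity)]
      linarith
    have hwi : 0 < σ * w i := by
      have : w i = ρ / 2 * σ := by simp [hw, hP, hi, hii]
      rw [this]; nlinarith
    have hwi' : 0 < σ' * w i' := by
      have : w i' = ρ / 2 * σ' := by simp [hw, hP, hi', hii.symm]
      rw [this]; nlinarith
    have a1 := abs_le.1 (step ρ hρ hρ1 j i hi σ hσ y hy hyP hs)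
    have a2 := abs_le.1 (step ρ hρ hρ1 j i hi σ hσ w hw0 hwP hwi)
    have a3 := abs_le.1 (step ρ hρ hρ1 j i' hi' σ' hσ' w hw0 hwP hwi')
    have a4 := abs_le.1 (step ρ hρ hρ1 j i' hi' σ' hσ' y' hy' hyP' hs')
    rw [abs_le]
    constructor <;> linarith [a1.1, a1.2, a2.1, a2.2, a3.1, a3.2, a4.1, a4.2]
  have hcoord : ∀ y : Euc n, y ∈ sliceSet n t → ∃ i, i ≠ 0 ∧ y i ≠ 0 := by
    rintro y ⟨hy0, hyP⟩
    by_contra hcon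
    push Not at hcon
    apply hyP
    ext i
    by_cases hi : i = 0
    · subst hi; simp [hy0]
    · rw [hcon i hi]; simp [hi]
  have pair : ∀ ρ, 0 < ρ → ρ < 1 / 20 → ∀ j : Fin n, ∀ y ∈ sliceSet n t, ∀ y' ∈ sliceSet n t,
      ‖y - P‖ ≤ ρ → ‖y' - P‖ ≤ ρ → |f y j - f y' j| ≤ 8 * E ρ := by
    intro ρ hρ hρ1 j y hy y' hy' hyP hyP'
    obtain ⟨i, hi, hyi⟩ := hcoord y hy
    obtain ⟨i', hi', hyi'⟩ := hcoord y' hy'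
    have hE0 := hEnn ρ hρ
    by_cases hii : i = i'
    · subst hii
      obtain ⟨l, hl, hli⟩ : ∃ l : Fin n, l ≠ 0 ∧ l ≠ i := by
        have hcard : ({0, i} : Finset (Fin n)).card < Fintype.card (Fin n) := by
          have := Finset.card_le_two (a := (0 : Fin n)) (b := i)
          rw [Fintype.card_fin]; omega
        obtain ⟨l, hl⟩ := Finset.exists_mem_notMem_of_card_lt_card (s := ({0, i} : Finset (Fin n)))
          (t := Finset.univ) (by simpa using hcard)
        simp at hl
        exact ⟨l, hl.1, hl.2⟩
      set w : Euc n := P + EuclideanSpace.single l ρ with hw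
      have hw0 : w 0 = t := by simp [hw, hP, hl.symm]
      have hwP : ‖w - P‖ ≤ ρ := by
        rw [hw, add_sub_cancel_left, PiLp.norm_single, Real.norm_of_nonneg hρ.le]
      have hwl : w l ≠ 0 := by simp [hw, hP, hl, hρ.ne']
      have a1 := abs_le.1 (pair1 ρ hρ hρ1 j i l hi hl hli.symm y w hy.1 hw0 hyP hwP hyi hwl)
      have a2 := abs_le.1 (pair1 ρ hρ hρ1 j l i hl hi hli w y' hw0 hy'.1 hwP hyP' hwl hyi')
      rw [abs_le]
      constructor <;> linarith [a1.1, a1.2, a2.1, a2.2]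
    · have := pair1 ρ hρ hρ1 j i i' hi hi' hii y y' hy.1 hy'.1 hyP hyP' hyi hyi'
      linarith
  have hne : (nhdsWithin P (sliceSet n t)).NeBot := by
    have h1 : (1 : ℕ) < n := by omega
    exact (curve_tendsto (n := n) t ⟨1, h1⟩ (by intro h; simpa using congrArg Fin.val h)).neBot
  have hEt : Filter.Tendsto (fun ρ => 8 * E ρ) (nhdsWithin 0 (Ioi 0)) (nhds 0) := by
    have h1 : ContinuousAt (fun ρ : ℝ => 8 * E ρ) 0 := by
      simp only [hE]
      have := Real.continuousAt_rpow_const 0 γ (Or.inr hγ0.le)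
      fun_prop
    have h2 := h1.tendsto
    simp only [hE, Real.zero_rpow hγ0.ne', mul_zero] at h2
    exact h2.mono_left nhdsWithin_le_nhds
  have hlim : ∀ j, ∃ cj, Filter.Tendsto (fun y => f y j) (nhdsWithin P (sliceSet n t)) (nhds cj) := by
    intro j
    rw [← cauchy_map_iff_exists_tendsto]
    rw [Metric.cauchy_iff]
    refine ⟨inferInstance, fun ε hε => ?_⟩
    have hev := (hEt.eventually (gt_mem_nhds hε)).and (((eventually_lt_nhds (by norm_num : (0 : ℝ) < 1 / 20)).filter_mono
      nhdsWithin_le_nhds).and (self_mem_nhdsWithin (s := Ioi (0 : ℝ)) (a := 0)))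
    obtain ⟨ρ, h1, h2, h3⟩ := hev.exists
    have h3 : 0 < ρ := h3
    refine ⟨(fun y => f y j) '' (sliceSet n t ∩ closedBall P ρ), ?_, ?_⟩
    · apply Filter.image_mem_map
      exact Filter.inter_mem self_mem_nhdsWithin (nhdsWithin_le_nhds (closedBall_mem_nhds _ h3))
    · rintro _ ⟨y, ⟨hy, hyb⟩, rfl⟩ _ ⟨y', ⟨hy', hyb'⟩, rfl⟩
      rw [mem_closedBall, dist_eq_norm] at hyb hyb'
      exact (pair ρ h3 h2 j y hy y' hy' hyb hyb').trans_lt h1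
  choose cj hcj using hlim
  refine ⟨WithLp.toLp 2 cj, ?_⟩
  have h1 : Filter.Tendsto (fun y => (fun j => f y j)) (nhdsWithin P (sliceSet n t)) (nhds cj) :=
    tendsto_pi_nhds.2 hcj
  exact ((PiLp.continuous_toLp 2 (fun _ : Fin n => ℝ)).tendsto cj).comp h1


def Nfun {n : ℕ} [NeZero n] (y : Euc n) : ℝ := max (y 0) (‖y‖ - 1 / 4)

lemma Nfun_cont {n : ℕ} [NeZero n] : Continuous (Nfun (n := n)) := by
  unfold Nfun; fun_prop

lemma single_norm {n : ℕ} [NeZero n] {t : ℝ} (ht : 0 < t) : ‖(EuclideanSpace.single 0 t : Euc n)‖ = t := by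
  rw [PiLp.norm_single, Real.norm_of_nonneg ht.le]

lemma Nfun_single {n : ℕ} [NeZero n] {t : ℝ} (ht : 0 < t) : Nfun (EuclideanSpace.single 0 t : Euc n) = t := by
  unfold Nfun
  rw [single_norm ht]
  simp

lemma single_mem_slit {n : ℕ} [NeZero n] {t : ℝ} (ht : 0 < t) (ht1 : t < 1) :
    (EuclideanSpace.single 0 t : Euc n) ∈ slit n := by
  refine ⟨by simp [ht.le], by simp [ht1], fun i hi => by simp [hi]⟩

lemma slit_eq {n : ℕ} [NeZero n] {y : Euc n} (hy : y ∈ slit n) : y = EuclideanSpace.single 0 (y 0) := by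
  ext i
  by_cases hi : i = 0
  · subst hi; simp
  · rw [hy.2.2 i hi]; simp [hi]

lemma slice_mem {n : ℕ} [NeZero n] {t : ℝ} (ht : 0 < t) (ht1 : t < 1 / 2) :
    ∀ᶠ y in nhdsWithin (EuclideanSpace.single 0 t : Euc n) (sliceSet n t), y ∈ unitBall n \ slit n := by
  have h1 : ∀ᶠ y in nhdsWithin (EuclideanSpace.single 0 t : Euc n) (sliceSet n t), y ∈ unitBall n := by
    refine nhdsWithin_le_nhds (isOpen_ball.mem_nhds ?_)
    rw [mem_ball_zero_iff, single_norm ht]; linarith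
  filter_upwards [h1, self_mem_nhdsWithin] with y hy hys
  refine ⟨hy, fun hsl => hys.2 ?_⟩
  rw [slit_eq hsl, hys.1]

lemma level_mem {n : ℕ} [NeZero n] {t : ℝ} (ht : 0 < t) (ht1 : t < 1 / 2) {y : Euc n} (hy : Nfun y = t)
    (hne : y ≠ EuclideanSpace.single 0 t) : y ∈ unitBall n \ slit n := by
  have h2 : ‖y‖ - 1 / 4 ≤ t := hy ▸ le_max_right _ _
  refine ⟨by rw [unitBall, mem_ball_zero_iff]; linarith, fun hsl => hne ?_⟩
  have h3 := slit_eq hsl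
  have hy0 : 0 ≤ y 0 := hsl.1
  have : y 0 = t := by
    have h4 : ‖y‖ = y 0 := by
      conv_lhs => rw [h3]
      rw [PiLp.norm_single, Real.norm_of_nonneg hy0]
    have h5 := hy
    unfold Nfun at h5
    rw [h4, max_eq_left (by linarith)] at h5
    exact h5
  rw [h3, this]

lemma slice_neBot {n : ℕ} [NeZero n] (hn : 3 ≤ n) (t : ℝ) :
    (nhdsWithin (EuclideanSpace.single 0 t : Euc n) (sliceSet n t)).NeBot := by
  have h1 : (1 : ℕ) < n := by omega
  exact (curve_tendsto (n := n) t ⟨1, h1⟩ (by intro h; simpa using congrArg Fin.val h)).neBot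

lemma limit_norm {n : ℕ} [NeZero n] (hn : 3 ≤ n) {h f : Euc n → Euc n}
    (H : IsHomeoOn h f (unitBall n) (unitBall n \ slit n)) {t : ℝ} (ht : 0 < t) (ht1 : t < 1 / 2) {c : Euc n}
    (hc : Filter.Tendsto f (nhdsWithin (EuclideanSpace.single 0 t) (sliceSet n t)) (nhds c)) : ‖c‖ = 1 := by
  have hne := slice_neBot hn t
  have hmem := slice_mem (n := n) ht ht1
  have hle : ‖c‖ ≤ 1 := by
    refine le_of_tendsto hc.norm ?_
    filter_upwards [hmem] with y hy
    have := H.mapsTo_inv hy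
    rw [unitBall, mem_ball_zero_iff] at this
    exact this.le
  by_contra hcon
  have hlt : c ∈ unitBall n := by
    rw [unitBall, mem_ball_zero_iff]; exact lt_of_le_of_ne hle hcon
  have h1 : ContinuousAt h c := H.continuousOn.continuousAt (isOpen_ball.mem_nhds hlt)
  have h2 := h1.tendsto.comp hc
  have h3 : Filter.Tendsto (h ∘ f) (nhdsWithin (EuclideanSpace.single 0 t) (sliceSet n t))
      (nhds (EuclideanSpace.single 0 t)) := by
    have h4 : Filter.Tendsto (id : Euc n → Euc n) (nhdsWithin (EuclideanSpace.single 0 t) (sliceSet n t))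
      (nhds (EuclideanSpace.single 0 t)) := nhdsWithin_le_nhds
    refine h4.congr' ?_
    filter_upwards [hmem] with y hy
    exact (H.right_inv y hy).symm
  have h5 := tendsto_nhds_unique h2 h3
  have h6 := (H.mapsTo hlt).2
  rw [h5] at h6
  exact h6 (single_mem_slit ht (by linarith))

lemma sphere_preconn {n : ℕ} (c : Euc n) (hc : ‖c‖ = 1) :
    IsPreconnected (sphere (0 : Euc n) 1 \ {c}) := by
  have h1 : IsPreconnected ((stereographic hc).symm '' univ) :=
    isPreconnected_univ.image _ (by
      have := (stereographic hc).continuousOn_symm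
      rwa [stereographic_target] at this)
  have h2 := h1.image Subtype.val continuous_subtype_val.continuousOn
  have h3 : (stereographic hc).symm '' univ = {⟨c, by simp [hc]⟩}ᶜ := by
    rw [← stereographic_target hc, OpenPartialHomeomorph.symm_image_target_eq_source, stereographic_source]
  rw [h3] at h2
  convert h2 using 1
  ext x
  simp only [mem_sdiff, mem_singleton_iff, mem_image, mem_compl_iff, Subtype.exists]
  constructor
  · rintro ⟨hx, hxc⟩
    exact ⟨x, hx, by simpa [Subtype.ext_iff] using hxc, rfl⟩
  · rintro ⟨y, hy, hyc, rfl⟩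
    exact ⟨hy, by simpa [Subtype.ext_iff] using hyc⟩

lemma sphere_neBot {n : ℕ} {x : Euc n} (hx : x ∈ sphere (0 : Euc n) 1) :
    (nhdsWithin x (unitBall n)).NeBot := by
  rw [← mem_closure_iff_nhdsWithin_neBot, unitBall, closure_ball _ one_ne_zero]
  exact sphere_subset_closedBall hx

lemma image_compact {n : ℕ} [NeZero n] {h f : Euc n → Euc n}
    (H : IsHomeoOn h f (unitBall n) (unitBall n \ slit n)) {t : ℝ} (ht : 0 < t) (ht1 : t < 1 / 2) {c : Euc n}
    (hc : Filter.Tendsto f (nhdsWithin (EuclideanSpace.single 0 t) (sliceSet n t)) (nhds c)) :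
    IsCompact ((Function.update f (EuclideanSpace.single 0 t) c) '' {y | Nfun y = t}) := by
  classical
  refine IsCompact.image_of_continuousOn ?_ ?_
  · refine (isCompact_closedBall (0 : Euc n) 1).of_isClosed_subset (isClosed_eq Nfun_cont continuous_const) ?_
    intro y hy
    have hy : Nfun y = t := hy
    have h2 : ‖y‖ - 1 / 4 ≤ t := hy ▸ le_max_right _ _
    rw [mem_closedBall_zero_iff]; linarith
  · intro y hy
    by_cases hyP : y = EuclideanSpace.single 0 t
    · subst hyP
      rw [continuousWithinAt_update_same]
      refine hc.mono_left ?_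
      rw [nhdsWithin, nhdsWithin, le_inf_iff]
      refine ⟨inf_le_left, ?_⟩
      rw [Filter.le_principal_iff]
      have hev : ∀ᶠ w in nhdsWithin (EuclideanSpace.single 0 t : Euc n)
          ({y | Nfun y = t} \ {EuclideanSpace.single 0 t}), ‖w‖ < t + 1 / 4 := by
        have : ContinuousAt (fun w : Euc n => ‖w‖) (EuclideanSpace.single 0 t) := by fun_prop
        refine nhdsWithin_le_nhds (this.eventually (gt_mem_nhds ?_))
        show ‖(EuclideanSpace.single 0 t : Euc n)‖ < t + 1 / 4
        rw [single_norm ht]; linarith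
      filter_upwards [hev, self_mem_nhdsWithin] with w hw hwm
      refine ⟨?_, hwm.2⟩
      have h5 : Nfun w = t := hwm.1
      unfold Nfun at h5
      rcases max_choice (w 0) (‖w‖ - 1 / 4) with h6 | h6
      · rw [← h5, h6]
      · rw [h6] at h5; linarith
    · refine (continuousAt_update_of_ne hyP).2 ?_ |>.continuousWithinAt
      exact H.continuousOn_inv.continuousAt (slit_open.mem_nhds (level_mem ht ht1 hy hyP))

lemma topo_key {n : ℕ} [NeZero n] {h f : Euc n → Euc n}
    (H : IsHomeoOn h f (unitBall n) (unitBall n \ slit n)) {t : ℝ} (ht : 0 < t) (ht1 : t < 1 / 2) {c : Euc n}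
    (hcn : ‖c‖ = 1)
    (hc : Filter.Tendsto f (nhdsWithin (EuclideanSpace.single 0 t) (sliceSet n t)) (nhds c)) :
    (∀ x ∈ sphere (0 : Euc n) 1, x ≠ c → ∀ᶠ z in nhdsWithin x (unitBall n), t < Nfun (h z)) ∨
    (∀ x ∈ sphere (0 : Euc n) 1, x ≠ c → ∀ᶠ z in nhdsWithin x (unitBall n), Nfun (h z) < t) := by
  classical
  have hK := (image_compact H ht ht1 hc).isClosed
  set K := (Function.update f (EuclideanSpace.single 0 t) c) '' {y | Nfun y = t} with hKdef
  have hzK : ∀ z ∈ unitBall n, Nfun (h z) = t → z ∈ K := by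
    intro z hz hzt
    refine ⟨h z, hzt, ?_⟩
    have hne : h z ≠ EuclideanSpace.single 0 t := by
      intro he
      have := (H.mapsTo hz).2
      rw [he] at this
      exact this (single_mem_slit ht (by linarith))
    rw [Function.update_of_ne hne, H.left_inv z hz]
  have hKB : ∀ x ∈ sphere (0 : Euc n) 1, x ≠ c → x ∉ K := by
    rintro x hx hxc ⟨y, hy, hyx⟩
    by_cases hyP : y = EuclideanSpace.single 0 t
    · subst hyP
      rw [Function.update_self] at hyx
      exact hxc hyx.symm
    · rw [Function.update_of_ne hyP] at hyx
      have := H.mapsTo_inv (level_mem ht ht1 hy hyP)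
      rw [hyx, unitBall, mem_ball_zero_iff] at this
      rw [mem_sphere_zero_iff_norm] at hx
      linarith
  set U : Set (Euc n) := {x | ∀ᶠ z in nhdsWithin x (unitBall n), t < Nfun (h z)} with hU
  set V : Set (Euc n) := {x | ∀ᶠ z in nhdsWithin x (unitBall n), Nfun (h z) < t} with hV
  have hUo : IsOpen U := isOpen_iff_mem_nhds.2 fun x hx => eventually_nhds_nhdsWithin.2 hx
  have hVo : IsOpen V := isOpen_iff_mem_nhds.2 fun x hx => eventually_nhds_nhdsWithin.2 hx
  have hcover : sphere (0 : Euc n) 1 \ {c} ⊆ U ∪ V := by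
    rintro x ⟨hx, hxc⟩
    obtain ⟨r, hr, hrK⟩ := Metric.isOpen_iff.1 hK.isOpen_compl x (hKB x hx hxc)
    set W := ball x r ∩ unitBall n with hW
    have hWm : W ∈ nhdsWithin x (unitBall n) :=
      Filter.inter_mem (nhdsWithin_le_nhds (ball_mem_nhds _ hr)) self_mem_nhdsWithin
    have hpre : IsPreconnected W := ((convex_ball x r).inter (convex_ball _ _)).isPreconnected
    have hcont : ContinuousOn (fun z => Nfun (h z)) W :=
      Nfun_cont.comp_continuousOn (H.continuousOn.mono inter_subset_right)
    have himg := hpre.image _ hcont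
    have hnt : ∀ z ∈ W, Nfun (h z) ≠ t := fun z hz he => hrK hz.1 (hzK z hz.2 he)
    by_cases hex : ∃ z ∈ W, t < Nfun (h z)
    · left
      obtain ⟨z0, hz0, hz0t⟩ := hex
      refine Filter.mem_of_superset hWm fun z hz => ?_
      by_contra hcon
      have hcon : ¬ t < Nfun (h z) := hcon
      have := himg.Icc_subset (mem_image_of_mem _ hz) (mem_image_of_mem _ hz0) ⟨not_lt.1 hcon, hz0t.le⟩
      obtain ⟨w, hw, hwt⟩ := this
      exact hnt w hw hwt
    · right
      push Not at hex
      refine Filter.mem_of_superset hWm fun z hz => ?_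
      exact lt_of_le_of_ne (hex z hz) (hnt z hz)
  have hdisj : (sphere (0 : Euc n) 1 \ {c}) ∩ (U ∩ V) = ∅ := by
    rw [eq_empty_iff_forall_notMem]
    rintro x ⟨⟨hx, _⟩, hxU, hxV⟩
    have := sphere_neBot hx
    have hxU : ∀ᶠ z in nhdsWithin x (unitBall n), t < Nfun (h z) := hxU
    have hxV : ∀ᶠ z in nhdsWithin x (unitBall n), Nfun (h z) < t := hxV
    obtain ⟨z, h1, h2⟩ := (hxU.and hxV).exists
    linarith
  rcases isPreconnected_iff_subset_of_disjoint.1 (sphere_preconn c hcn) U V hUo hVo hcover hdisj with h1 | h1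
  · exact Or.inl fun x hx hxc => h1 ⟨hx, hxc⟩
  · exact Or.inr fun x hx hxc => h1 ⟨hx, hxc⟩

lemma topo_level {n : ℕ} [NeZero n] (hn : 3 ≤ n) {h f : Euc n → Euc n}
    (H : IsHomeoOn h f (unitBall n) (unitBall n \ slit n)) {s : ℝ} (ht : 0 < s) (ht1 : s < 1 / 2) {c : Euc n}
    (hc : Filter.Tendsto f (nhdsWithin (EuclideanSpace.single 0 s) (sliceSet n s)) (nhds c))
    {P : ℝ → Prop} (hP : ∀ᶠ x in nhds s, P x) {Q : ℝ → Prop}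
    (hQ : ∀ᶠ z in nhdsWithin c (unitBall n), Q (Nfun (h z))) : ∃ x, P x ∧ Q x := by
  have hne := slice_neBot hn s
  have hmem := slice_mem (n := n) ht ht1
  have h1 : Filter.Tendsto f (nhdsWithin (EuclideanSpace.single 0 s) (sliceSet n s)) (nhdsWithin c (unitBall n)) :=
    tendsto_nhdsWithin_iff.2 ⟨hc, hmem.mono fun y hy => H.mapsTo_inv hy⟩
  have h2 : Filter.Tendsto (Nfun (n := n)) (nhdsWithin (EuclideanSpace.single 0 s) (sliceSet n s)) (nhds s) := by
    have := Nfun_cont.tendsto (EuclideanSpace.single 0 s : Euc n)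
    rw [Nfun_single ht] at this
    exact this.mono_left nhdsWithin_le_nhds
  obtain ⟨y, hy1, hy2, hy3⟩ := ((h1.eventually hQ).and ((h2.eventually hP).and hmem)).exists
  refine ⟨Nfun y, hy2, ?_⟩
  rwa [H.right_inv y hy3] at hy1

/-- Three good levels give two distinct levels with the same limit. -/
lemma two_levels {n : ℕ} [NeZero n] (hn : 3 ≤ n) {h f : Euc n → Euc n}
    (H : IsHomeoOn h f (unitBall n) (unitBall n \ slit n)) {t1 t2 t3 : ℝ} (h01 : 0 < t1) (h12 : t1 < t2)
    (h23 : t2 < t3) (h3 : t3 < 1 / 2)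
    (G : ∀ t ∈ ({t1, t2, t3} : Set ℝ), ∃ c, Filter.Tendsto f
      (nhdsWithin (EuclideanSpace.single 0 t) (sliceSet n t)) (nhds c)) :
    ∃ c ta tb, ‖c‖ = 1 ∧ 0 < ta ∧ ta < tb ∧ tb < 1 / 2 ∧
      Filter.Tendsto f (nhdsWithin (EuclideanSpace.single 0 ta) (sliceSet n ta)) (nhds c) ∧
      Filter.Tendsto f (nhdsWithin (EuclideanSpace.single 0 tb) (sliceSet n tb)) (nhds c) := by
  obtain ⟨c1, hc1⟩ := G t1 (by simp)
  obtain ⟨c2, hc2⟩ := G t2 (by simp)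
  obtain ⟨c3, hc3⟩ := G t3 (by simp)
  have n1 := limit_norm hn H h01 (by linarith) hc1
  have n2 := limit_norm hn H (by linarith) (by linarith) hc2
  have n3 := limit_norm hn H (by linarith) h3 hc3
  rcases topo_key H (by linarith) (by linarith) n2 hc2 with K | K
  · have : c1 = c2 := by
      by_contra hcon
      obtain ⟨x, hx1, hx2⟩ := topo_level hn H h01 (by linarith) hc1 (P := fun x => x < t2) (gt_mem_nhds h12)
        (Q := fun x => t2 < x) (K c1 (by simp [n1]) hcon)
      linarith
    subst this
    exact ⟨c1, t1, t2, n1, h01, h12, by linarith, hc1, hc2⟩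
  · have : c3 = c2 := by
      by_contra hcon
      obtain ⟨x, hx1, hx2⟩ := topo_level hn H (by linarith) h3 hc3 (P := fun x => t2 < x) (lt_mem_nhds h23)
        (Q := fun x => x < t2) (K c3 (by simp [n3]) hcon)
      linarith
    subst this
    exact ⟨c3, t2, t3, n3, by linarith, h23, h3, hc2, hc3⟩


lemma curve_ivt {n : ℕ} [NeZero n] (hn : 3 ≤ n) {h f : Euc n → Euc n}
    (H : IsHomeoOn h f (unitBall n) (unitBall n \ slit n)) {t : ℝ} (ht : 0 < t) (ht1 : t < 1 / 2) {c : Euc n}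
    (hcn : ‖c‖ = 1)
    (hc : Filter.Tendsto f (nhdsWithin (EuclideanSpace.single 0 t) (sliceSet n t)) (nhds c)) :
    ∃ r0 > 0, ∀ r, 0 < r → r < r0 → ∃ y ∈ unitBall n, dist y c = r ∧ h y 0 = t := by
  have h1n : (1 : ℕ) < n := by omega
  set i : Fin n := ⟨1, h1n⟩ with hidef
  have hi : i ≠ 0 := by intro h; simpa [hidef] using congrArg Fin.val h
  set γ : ℝ → Euc n := fun ε => EuclideanSpace.single 0 t + EuclideanSpace.single i ε with hγ
  have hγc : Continuous γ := by
    have : (fun ε : ℝ => (EuclideanSpace.single i ε : Euc n)) = fun ε => ε • EuclideanSpace.single i (1 : ℝ) := by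
      ext ε j; simp
    have h2 : Continuous (fun ε : ℝ => (EuclideanSpace.single i ε : Euc n)) := by rw [this]; fun_prop
    exact continuous_const.add h2
  have hγ0 : ∀ ε, γ ε 0 = t := fun ε => by simp [hγ, hi.symm]
  have hγY : ∀ ε ∈ Ioc (0 : ℝ) (1 / 4), γ ε ∈ unitBall n \ slit n := by
    intro ε hε
    constructor
    · rw [unitBall, mem_ball_zero_iff]
      refine (norm_add_le _ _).trans_lt ?_
      rw [single_norm ht, PiLp.norm_single, Real.norm_of_nonneg hε.1.le]
      linarith [hε.2]
    · intro hsl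
      have := hsl.2.2 i hi
      simp [hγ, hi] at this
      exact hε.1.ne' this
  have hlim : Filter.Tendsto (fun ε => dist (f (γ ε)) c) (nhdsWithin 0 (Ioi 0)) (nhds 0) := by
    have h1 := hc.comp (curve_tendsto (n := n) t i hi)
    exact tendsto_iff_dist_tendsto_zero.1 h1
  have hcont : ContinuousOn (fun ε => dist (f (γ ε)) c) (Ioc (0 : ℝ) (1 / 4)) :=
    (continuous_id.dist continuous_const).comp_continuousOn (H.continuousOn_inv.comp hγc.continuousOn hγY)
  have himg := isPreconnected_Ioc.image _ hcont
  have hm : (1 / 4 : ℝ) ∈ Ioc (0 : ℝ) (1 / 4) := by norm_num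
  refine ⟨dist (f (γ (1 / 4))) c, ?_, fun r hr hr1 => ?_⟩
  · have hb := H.mapsTo_inv (hγY _ hm)
    refine dist_pos.2 fun he => ?_
    rw [he, unitBall, mem_ball_zero_iff] at hb
    linarith
  · have hev : ∀ᶠ ε in nhdsWithin (0 : ℝ) (Ioi 0), ε ∈ Ioc (0 : ℝ) (1 / 4) :=
      Ioc_mem_nhdsGT (by norm_num)
    obtain ⟨ε, hε1, hε2⟩ := ((hlim.eventually (gt_mem_nhds hr)).and hev).exists
    obtain ⟨ε', hε', hr'⟩ := himg.Icc_subset (mem_image_of_mem _ hε2) (mem_image_of_mem _ hm) ⟨hε1.le, hr1.le⟩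
    refine ⟨f (γ ε'), H.mapsTo_inv (hγY _ hε'), hr', ?_⟩
    rw [H.right_inv _ (hγY _ hε')]
    exact hγ0 ε'

lemma opNorm_nonneg' {n : ℕ} (M : Matrix (Fin n) (Fin n) ℝ) : 0 ≤ opNorm M := norm_nonneg _

lemma final_contra {n : ℕ} [NeZero n] (hn : 3 ≤ n) {h : Euc n → Euc n}
    {Dh : Euc n → Matrix (Fin n) (Fin n) ℝ} (hcont : ContinuousOn h (unitBall n))
    (hS : MemSobolev (n : ℝ) (unitBall n) h Dh) {c : Euc n} (hcn : ‖c‖ = 1) {ta tb : ℝ} (hab : ta < tb)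
    (ha : ∃ r0 > 0, ∀ r, 0 < r → r < r0 → ∃ y ∈ unitBall n, dist y c = r ∧ h y 0 = ta)
    (hb : ∃ r0 > 0, ∀ r, 0 < r → r < r0 → ∃ y ∈ unitBall n, dist y c = r ∧ h y 0 = tb) : False := by
  have hn3 : (3 : ℝ) ≤ n := by exact_mod_cast hn
  obtain ⟨ra, hra, hya⟩ := ha
  obtain ⟨rb, hrb, hyb⟩ := hb
  obtain ⟨C, hC, hosc⟩ := osc_main n (n : ℝ) 6 (by linarith) (by linarith) (by norm_num)
  set δ := tb - ta with hδ
  have hδ0 : 0 < δ := by rw [hδ]; linarith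
  set η : ℝ := 2 / 7 * (δ / (4 * C)) ^ (n : ℝ) with hη
  have hη0 : 0 < η := by rw [hη]; positivity
  set F : Euc n → ℝ := fun x => opNorm (Dh x) ^ (n : ℝ) with hF
  have hF0 : ∀ x, 0 ≤ F x := fun x => Real.rpow_nonneg (opNorm_nonneg' _) _
  have hI : IntegrableOn F (unitBall n) := hS.lp

  obtain ⟨R, hR, hR1, hR2, hR3⟩ : ∃ R : ℝ, 0 < R ∧ R ≤ 1 / 10 ∧ 2 * R < min ra rb ∧
      10 * (∫ x in unitBall n ∩ ball c (10 * R), F x) < η := by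
    have hr0 : 0 < min ra rb := lt_min hra hrb
    have hm : ∀ k : ℕ, MeasurableSet (unitBall n ∩ ball c (1 / ((k : ℝ) + 1))) := fun k =>
      measurableSet_ball.inter measurableSet_ball
    have hanti : Antitone (fun k : ℕ => unitBall n ∩ ball c (1 / ((k : ℝ) + 1))) := by
      intro k l hkl
      exact inter_subset_inter_right _ (ball_subset_ball (Nat.one_div_le_one_div hkl))
    have h1 := tendsto_setIntegral_of_antitone (μ := volume) (f := F) hm hanti
      ⟨0, hI.mono_set inter_subset_left⟩
    have hemp : (⋂ k : ℕ, unitBall n ∩ ball c (1 / ((k : ℝ) + 1))) = ∅ := by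
      rw [eq_empty_iff_forall_notMem]
      intro x hx
      rw [mem_iInter] at hx
      have hxB := (hx 0).1
      have hxc : x ≠ c := by
        rintro rfl
        rw [unitBall, mem_ball_zero_iff] at hxB; linarith
      obtain ⟨k, hk⟩ := exists_nat_one_div_lt (dist_pos.2 hxc)
      have := (hx k).2
      rw [mem_ball] at this; linarith
    rw [hemp, setIntegral_empty] at h1
    have h2 := tendsto_one_div_add_atTop_nhds_zero_nat (𝕜 := ℝ)
    obtain ⟨k, hk1, hk2⟩ := ((h1.eventually (gt_mem_nhds (show 0 < η / 10 by positivity))).and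
      (h2.eventually (gt_mem_nhds (show 0 < min ra rb by positivity)))).exists
    have hkp : (0 : ℝ) < 1 / ((k : ℝ) + 1) := by positivity
    refine ⟨1 / ((k : ℝ) + 1) / 10, by positivity, ?_, ?_, ?_⟩
    · have : 1 / ((k : ℝ) + 1) ≤ 1 := by
        rw [div_le_one (by positivity)]; linarith [(Nat.cast_nonneg k : (0 : ℝ) ≤ k)]
      linarith
    · linarith
    · rw [show 10 * (1 / ((k : ℝ) + 1) / 10) = 1 / ((k : ℝ) + 1) by ring]
      linarith
  obtain ⟨r, hr, hgood⟩ := good_level (S := unitBall n ∩ ball c (10 * R)) hF0 (hI.mono_set inter_subset_left)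
    (pr := fun x => dist x c) (LipschitzWith.dist_left c) (a := R) (b := 2 * R) (lam := η / R) (by positivity)
    (by rw [show η / R * (2 * R - R) = η by field_simp; ring]; exact hR3)
  have hrpos : 0 < r := lt_of_lt_of_le hR hr.1
  have hrlt := lt_of_le_of_lt hr.2 hR2
  obtain ⟨ya, hyaB, hyad, hyat⟩ := hya r hrpos (hrlt.trans_le (min_le_left _ _))
  obtain ⟨yb, hybB, hybd, hybt⟩ := hyb r hrpos (hrlt.trans_le (min_le_right _ _))
  have key : ∀ y ∈ unitBall n, dist y c = r →
      |avg (unitBall n) (fun x => h x 0) ((1 - R) • c) (R / 2) - h y 0| ≤ δ / 4 := by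
    intro y hy hyd
    have hzn : ‖(1 - R) • c‖ = 1 - R := by
      rw [norm_smul, hcn, mul_one, Real.norm_of_nonneg (by linarith)]
    have := hosc (unitBall n) h Dh isOpen_ball hcont hS 0 (unitBall n) y ((1 - R) • c) (R / 2) (7 * (η / R))
      (convex_ball _ _) subset_rfl hy ?_ ?_ (by positivity) (by positivity) ?_
    · refine this.trans (le_of_eq ?_)
      have hex : 1 + (1 - (n : ℝ)) / n = 1 / n := by field_simp; ring
      rw [hex, ← Real.mul_rpow (by positivity) (by positivity),
        show 7 * (η / R) * (R / 2) = (δ / (4 * C)) ^ (n : ℝ) by rw [hη]; field_simp,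
        ← Real.rpow_mul (by positivity), mul_one_div_cancel (by positivity), Real.rpow_one]
      field_simp
    · intro w hw
      rw [mem_closedBall, dist_eq_norm] at hw
      rw [unitBall, mem_ball_zero_iff]
      have := norm_add_le (w - (1 - R) • c) ((1 - R) • c)
      rw [sub_add_cancel, hzn] at this; linarith
    · have h1 : dist ((1 - R) • c) c = R := by
        rw [dist_eq_norm, show (1 - R) • c - c = (-R) • c by rw [sub_smul, one_smul, neg_smul]; abel,
          norm_smul, hcn, mul_one, norm_neg, Real.norm_of_nonneg hR.le]
      have h2 := dist_triangle ((1 - R) • c) c y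
      rw [h1, dist_comm c y, hyd] at h2
      linarith [hr.2]
    · intro τ hτ
      have h1 := hgood ((6 + 1) * τ) (by have := hτ.1; linarith) y hyd
      have h2 : unitBall n ∩ closedBall y ((6 + 1) * τ) =
          unitBall n ∩ ball c (10 * R) ∩ closedBall y ((6 + 1) * τ) := by
        ext x
        simp only [mem_inter_iff]
        constructor
        · rintro ⟨hx1, hx2⟩
          refine ⟨⟨hx1, ?_⟩, hx2⟩
          rw [mem_closedBall] at hx2
          rw [mem_ball]
          have := dist_triangle x y c
          have h5 := hτ.2
          linarith [hr.2]
        · rintro ⟨⟨hx1, _⟩, hx2⟩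
          exact ⟨hx1, hx2⟩
      rw [h2]
      refine h1.trans (le_of_eq ?_)
      ring
  have k1 := abs_le.1 (key ya hyaB hyad)
  have k2 := abs_le.1 (key yb hybB hybd)
  rw [hyat] at k1
  rw [hybt] at k2
  linarith [k1.1, k1.2, k2.1, k2.2]

/-- For `n ≥ 3` and `p > n − 1` there is no homeomorphism
`h : 𝔹 → 𝔹 ∖ I` with `h ∈ W^{1,n}(𝔹)` and `h⁻¹ ∈ W^{1,p}(𝔹 ∖ I)`. -/
theorem stmt_4 {n : ℕ} [NeZero n] (hn : 3 ≤ n) (p : ℝ) (hp : (n : ℝ) - 1 < p) :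
    ¬ ∃ (h f : Euc n → Euc n) (Dh Df : Euc n → Matrix (Fin n) (Fin n) ℝ),
        IsHomeoOn h f (unitBall n) (unitBall n \ slit n) ∧
        MemSobolev (n : ℝ) (unitBall n) h Dh ∧
        MemSobolev p (unitBall n \ slit n) f Df := by
  rintro ⟨h, f, Dh, Df, H, hSh, hSf⟩
  have good : ∀ a : ℝ, ∃ s ∈ Icc a (a + 1 / 10), 0 < s → s < 1 / 2 →
      ∃ c, Filter.Tendsto f (nhdsWithin (EuclideanSpace.single 0 s) (sliceSet n s)) (nhds c) := by
    intro a
    set J := ∫ x in unitBall n \ slit n, opNorm (Df x) ^ p with hJ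
    have hF0 : ∀ x, 0 ≤ opNorm (Df x) ^ p := fun x => Real.rpow_nonneg (opNorm_nonneg' _) _
    have hJ0 : 0 ≤ J := integral_nonneg hF0
    have hl : 0 < 100 * J + 1 := by linarith
    obtain ⟨s, hs, hg⟩ := good_level (S := unitBall n \ slit n) hF0 hSf.lp (pr := fun x : Euc n => x 0)
      (LipschitzWith.of_dist_le_mul fun x y => by
        rw [NNReal.coe_one, one_mul, dist_eq_norm, dist_eq_norm]
        exact PiLp.norm_apply_le (x - y) 0)
      (a := a) (b := a + 1 / 10) hl (by rw [← hJ]; linarith)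
    exact ⟨s, hs, fun h0 h1 => slice_limit hn p hp H.continuousOn_inv hSf h0 h1 hl hg⟩
  obtain ⟨t1, ht1, g1⟩ := good (1 / 100)
  obtain ⟨t2, ht2, g2⟩ := good (15 / 100)
  obtain ⟨t3, ht3, g3⟩ := good (30 / 100)
  obtain ⟨l1, u1⟩ := ht1
  obtain ⟨l2, u2⟩ := ht2
  obtain ⟨l3, u3⟩ := ht3
  obtain ⟨c, ta, tb, hcn, ha0, hab, hb1, hca, hcb⟩ := two_levels hn H (t1 := t1) (t2 := t2) (t3 := t3)
    (by linarith) (by linarith) (by linarith) (by linarith) (by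
      rintro t (rfl | rfl | rfl)
      · exact g1 (by linarith) (by linarith)
      · exact g2 (by linarith) (by linarith)
      · exact g3 (by linarith) (by linarith))
  exact final_contra hn H.continuousOn hSh hcn hab (curve_ivt hn H ha0 (by linarith) hcn hca)
    (curve_ivt hn H (by linarith) hb1 hcn hcb)
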